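/- arXiv:2306.09040 — 6 statements merged into one kernel-verified Lean document; each statement's English description precedes it below -/
import Mathlib

section
/- Let n ≥ 2, let δ : Fin n × {a,b} → Fin n be a uniformly random transition function, and independently color each pair (x,c) ∈ Fin n × {a,b} red with probability p := 1/(log₂ n)² and blue otherwise, independently over pairs. For states x, y let d_b(x,y) denote the length of the shortest word ω with δ_ω(x) = δ_ω(y) such that every transition applied along both trajectories (every pair (state, letter) used when reading ω from x and from y) is blue, with d_b(x,y) = ∞ if no such word exists. Let L_b := {(x,y) ∈ (Fin n)² : d_b(x,y) > 2·log₂ n}. Then Pr(|L_b| ≥ n²/2) → 0 as n → ∞. -/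
open scoped BigOperators Classical

/-- `run δ ω x` applies the transitions of the word `ω` (over the two-letter
alphabet `Bool`, with `false = 'a'` and `true = 'b'`) starting from state `x`,
i.e. `run δ ω = δ_ω = δ_{ω_k} ∘ ⋯ ∘ δ_{ω_1}`. -/
def run {n : ℕ} (δ : Fin n × Bool → Fin n) : List Bool → Fin n → Fin n
  | [], x => x
  | c :: w, x => run δ w (δ (x, c))

/-- `usedPairs δ ω x` is the list of transition pairs `(state, letter)` that
are applied when reading the word `ω` starting from state `x`. -/
def usedPairs {n : ℕ} (δ : Fin n × Bool → Fin n) :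
    List Bool → Fin n → List (Fin n × Bool)
  | [], _ => []
  | c :: w, x => (x, c) :: usedPairs δ w (δ (x, c))

/-- The set `L_b` of pairs of states `(x,y)` with `d_b(x,y) > 2·log₂ n`:
no word `ω` of length at most `2·log₂ n` merges `x` and `y` while using only
blue transition pairs (`col pr = false` means `pr` is blue, `true` red). -/
noncomputable def Lb (n : ℕ) (δ : Fin n × Bool → Fin n)
    (col : Fin n × Bool → Bool) : Finset (Fin n × Fin n) :=
  Finset.univ.filter (fun xy : Fin n × Fin n =>
    ¬ ∃ ω : List Bool, (ω.length : ℝ) ≤ 2 * Real.logb 2 n ∧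
        run δ ω xy.1 = run δ ω xy.2 ∧
        ∀ pr ∈ usedPairs δ ω xy.1 ++ usedPairs δ ω xy.2, col pr = false)

/-- The average of `f` over all functions that agree with `δ₀` on `K`. -/
noncomputable def condAvg {κ V : Type*} [Fintype κ] [Fintype V] [DecidableEq κ]
    (K : Finset κ) (δ₀ : κ → V) (f : (κ → V) → ℝ) : ℝ :=
  (∑ δ : κ → V, f (K.piecewise δ₀ δ)) / Fintype.card (κ → V)

lemma piecewise_insert_update {κ V : Type*} [DecidableEq κ] (K : Finset κ) (δ₀ δ : κ → V) (k : κ) (v : V) (hk : k ∉ K) :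
    (insert k K).piecewise (Function.update δ₀ k v) δ
      = K.piecewise δ₀ (Function.update δ k v) := by
  ext j
  by_cases hj : j = k
  · subst hj; simp [hk]
  · by_cases hjK : j ∈ K <;> simp [Finset.piecewise, hj, hjK]

section CondAvg

variable {κ V : Type*} [Fintype κ] [Fintype V] [DecidableEq κ]

lemma sum_sum_update (k : κ) (G : (κ → V) → ℝ) :
    ∑ v : V, ∑ δ : κ → V, G (Function.update δ k v) = Fintype.card V * ∑ δ, G δ := by
  rw [← Fintype.sum_prod_type' (f := fun v δ => G (Function.update δ k v))]
  have h : ∑ p : V × (κ → V), G (Function.update p.2 k p.1) = ∑ p : V × (κ → V), G p.2 := by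
    refine Finset.sum_nbij' (fun p => (p.2 k, Function.update p.2 k p.1))
      (fun p => (p.2 k, Function.update p.2 k p.1)) ?_ ?_ ?_ ?_ ?_ <;> simp
  rw [h, Fintype.sum_prod_type]
  simp

lemma condAvg_reveal [Nonempty V] (K : Finset κ) (δ₀ : κ → V) (f : (κ → V) → ℝ) (k : κ)
    (hk : k ∉ K) :
    condAvg K δ₀ f
      = (∑ v : V, condAvg (insert k K) (Function.update δ₀ k v) f) / Fintype.card V := by
  have hc : (Fintype.card V : ℝ) ≠ 0 := by exact_mod_cast Fintype.card_ne_zero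
  unfold condAvg
  rw [← Finset.sum_div]
  simp_rw [piecewise_insert_update K δ₀ _ k _ hk]
  rw [sum_sum_update k (fun δ => f (K.piecewise δ₀ δ))]
  field_simp

lemma condAvg_mono (K : Finset κ) (δ₀ : κ → V) {f g : (κ → V) → ℝ}
    (h : ∀ δ, (∀ k ∈ K, δ k = δ₀ k) → f δ ≤ g δ) : condAvg K δ₀ f ≤ condAvg K δ₀ g := by
  unfold condAvg
  gcongr with δ
  apply h
  intro k hk
  simp [hk]

lemma condAvg_const [Nonempty V] (K : Finset κ) (δ₀ : κ → V) (c : ℝ) :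
    condAvg K δ₀ (fun _ => c) = c := by
  have hc : (Fintype.card (κ → V) : ℝ) ≠ 0 := by exact_mod_cast Fintype.card_ne_zero
  unfold condAvg
  simp only [Finset.sum_const, Finset.card_univ, nsmul_eq_mul]
  field_simp

/-- Revealing one more value: a bound for `condAvg` that is affine in a function `A` of the
revealed value may be averaged over that value if the value is fresh. -/
lemma condAvg_le_of_reveal [Nonempty V] (K : Finset κ) (δ₀ : κ → V) (f : (κ → V) → ℝ) (k : κ)
    (a b α : ℝ) (A : V → ℝ) (hb : 0 ≤ b)
    (h : ∀ δ₁ : κ → V, (∀ j ∈ K, δ₁ j = δ₀ j) → (∀ j, j ≠ k → δ₁ j = δ₀ j) →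
      condAvg (insert k K) δ₁ f ≤ a + b * A (δ₁ k))
    (hold : k ∈ K → ∀ v, A v ≤ α)
    (hnew : k ∉ K → ∑ v, A v ≤ Fintype.card V * α) :
    condAvg K δ₀ f ≤ a + b * α := by
  by_cases hk : k ∈ K
  · have := h δ₀ (fun _ _ => rfl) (fun _ _ => rfl)
    rw [Finset.insert_eq_of_mem hk] at this
    have h2 := mul_le_mul_of_nonneg_left (hold hk (δ₀ k)) hb
    linarith
  · have hc : (0 : ℝ) < Fintype.card V := by exact_mod_cast Fintype.card_pos
    rw [condAvg_reveal K δ₀ f k hk, div_le_iff₀ hc]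
    calc ∑ v : V, condAvg (insert k K) (Function.update δ₀ k v) f
        ≤ ∑ v : V, (a + b * A v) := by
          refine Finset.sum_le_sum fun v _ => ?_
          have := h (Function.update δ₀ k v)
            (fun j hj => Function.update_of_ne (by rintro rfl; exact hk hj) _ _)
            (fun j hj => Function.update_of_ne hj _ _)
          simpa using this
      _ = Fintype.card V * a + b * ∑ v, A v := by
          rw [Finset.sum_add_distrib, ← Finset.mul_sum]; simp
      _ ≤ Fintype.card V * a + b * (Fintype.card V * α) := by
          gcongr; exact hnew hk
      _ = (a + b * α) * Fintype.card V := by ring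

lemma condAvg_le_of_forall_reveal_pair [Nonempty V] (K : Finset κ) (δ₀ : κ → V)
    (f : (κ → V) → ℝ) (k j : κ) (a : ℝ)
    (h : ∀ δ₁ : κ → V, condAvg (insert j (insert k K)) δ₁ f ≤ a) : condAvg K δ₀ f ≤ a := by
  have one : ∀ (K : Finset κ) (k : κ) (δ₀ : κ → V),
      (∀ δ₁ : κ → V, condAvg (insert k K) δ₁ f ≤ a) → condAvg K δ₀ f ≤ a := by
    intro K k δ₀ h
    have := condAvg_le_of_reveal K δ₀ f k a 0 0 (fun _ => 0) le_rfl
      (fun δ₁ _ _ => by simpa using h δ₁) (by simp) (by simp)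
    simpa using this
  exact one K k δ₀ fun δ₁ => one _ j δ₁ h

lemma condAvg_eq_le [Nonempty V] [DecidableEq V] (K : Finset κ) (δ₀ : κ → V) (k j : κ) (hkj : k ≠ j)
    (hk : k ∉ K) :
    condAvg K δ₀ (fun δ => if δ k = δ j then 1 else 0) ≤ 1 / Fintype.card V := by
  have hc : (0 : ℝ) < Fintype.card V := by exact_mod_cast Fintype.card_pos
  have key : ∀ (K : Finset κ) (δ₀ : κ → V), k ∉ K → j ∈ K →
      condAvg K δ₀ (fun δ => if δ k = δ j then 1 else 0) ≤ 0 + 1 * (1 / Fintype.card V) := by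
    intro K δ₀ hk hj
    refine condAvg_le_of_reveal K δ₀ _ k 0 1 _ (fun v => if v = δ₀ j then 1 else 0)
      zero_le_one ?_ (fun h => absurd h hk) ?_
    · intro δ₁ h1 _
      rw [zero_add, one_mul, ← condAvg_const (insert k K) δ₁ (if δ₁ k = δ₀ j then 1 else 0)]
      refine condAvg_mono _ _ fun δ hδ => ?_
      rw [hδ k (by simp), hδ j (by simp [hj]), h1 j hj]
    · intro _
      simp [hc.ne']
  have := condAvg_le_of_reveal K δ₀ (fun δ => if δ k = δ j then 1 else 0) j
    (1 / Fintype.card V) 0 0 (fun _ => 0) le_rfl (fun δ₁ _ _ => by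
      simpa using key (insert j K) δ₁ (by simp [hkj, hk]) (by simp)) (by simp) (by simp)
  simpa using this

end CondAvg

/-- Reading `w` from `x` and `y` visits pairwise distinct states outside `F`, except that the two
trajectories end in a common state. -/
def FreshMerge {n : ℕ} (δ : Fin n × Bool → Fin n) :
    Finset (Fin n) → List Bool → Fin n → Fin n → Prop
  | _, [], x, y => x = y
  | F, c :: w, x, y => x ∉ F ∧ y ∉ F ∧ x ≠ y ∧
      FreshMerge δ (insert x (insert y F)) w (δ (x, c)) (δ (y, c))

lemma FreshMerge.run_eq {n : ℕ} {δ : Fin n × Bool → Fin n} {F : Finset (Fin n)} {w : List Bool}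
    {x y : Fin n} (h : FreshMerge δ F w x y) : run δ w x = run δ w y := by
  induction w generalizing F x y with
  | nil => exact h
  | cons c w ih => exact ih h.2.2.2

/-- Indicator of `FreshMerge`. -/
noncomputable def fmInd {n : ℕ} (F : Finset (Fin n)) (w : List Bool) (x y : Fin n)
    (δ : Fin n × Bool → Fin n) : ℝ :=
  if FreshMerge δ F w x y then 1 else 0

section Bounds

variable {n : ℕ}

lemma fmInd_nonneg (F : Finset (Fin n)) (w : List Bool) (x y : Fin n)
    (δ : Fin n × Bool → Fin n) : 0 ≤ fmInd F w x y δ := by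
  unfold fmInd; split_ifs <;> norm_num

lemma fmInd_le_one (F : Finset (Fin n)) (w : List Bool) (x y : Fin n)
    (δ : Fin n × Bool → Fin n) : fmInd F w x y δ ≤ 1 := by
  unfold fmInd; split_ifs <;> norm_num

lemma fmInd_nil (F : Finset (Fin n)) (x y : Fin n) (δ : Fin n × Bool → Fin n) :
    fmInd F [] x y δ = if x = y then 1 else 0 := by
  by_cases h : x = y <;> simp [fmInd, FreshMerge, h]

lemma fmInd_cons_eq_zero {F : Finset (Fin n)} {x y : Fin n}
    (h : ¬ (x ∉ F ∧ y ∉ F ∧ x ≠ y)) (c : Bool) (w : List Bool)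
    (δ : Fin n × Bool → Fin n) : fmInd F (c :: w) x y δ = 0 := by
  unfold fmInd
  exact if_neg fun h1 => h ⟨h1.1, h1.2.1, h1.2.2.1⟩

lemma fmInd_cons_eq {F : Finset (Fin n)} {x y : Fin n}
    (h : x ∉ F ∧ y ∉ F ∧ x ≠ y) (c : Bool) (w : List Bool)
    (δ : Fin n × Bool → Fin n) :
    fmInd F (c :: w) x y δ = fmInd (insert x (insert y F)) w (δ (x, c)) (δ (y, c)) δ := by
  unfold fmInd
  simp [FreshMerge, h]

/-- An upper bound for the probability that the trajectory of `w` started in `x` ends by using a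
transition of `K₀`, where `s` bounds the size of `K₀`. -/
noncomputable def hitBound (K₀ : Finset (Fin n × Bool)) (s : ℕ) : List Bool → Fin n → ℝ
  | [], _ => 1
  | c :: u, x => if (x, c) ∈ K₀ then 1 else (u.length * s : ℝ) / n

lemma hitBound_nonneg (K₀ : Finset (Fin n × Bool)) (s : ℕ) (w : List Bool) (x : Fin n) :
    0 ≤ hitBound K₀ s w x := by
  cases w with
  | nil => simp [hitBound]
  | cons c u => simp only [hitBound]; split_ifs <;> positivity

lemma hitBound_le_one (K₀ : Finset (Fin n × Bool)) (s : ℕ) (w : List Bool) (x : Fin n)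
    (h : w.length * s ≤ n) : hitBound K₀ s w x ≤ 1 := by
  cases w with
  | nil => simp [hitBound]
  | cons c u =>
    simp only [hitBound]
    split_ifs
    · exact le_rfl
    · apply div_le_one_of_le₀ _ (by positivity)
      have : u.length * s ≤ n := le_trans (Nat.mul_le_mul_right _ (by simp)) h
      exact_mod_cast this

lemma sum_hitBound_le (K₀ : Finset (Fin n × Bool)) (s : ℕ) (hs : K₀.card ≤ s) (c : Bool)
    (u : List Bool) :
    ∑ v : Fin n, hitBound K₀ s (c :: u) v ≤ ((u.length + 1 : ℕ) * s : ℝ) := by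
  have h1 : ∑ v : Fin n, hitBound K₀ s (c :: u) v
      ≤ ∑ v : Fin n, ((if (v, c) ∈ K₀ then (1 : ℝ) else 0) + (u.length * s : ℝ) / n) := by
    refine Finset.sum_le_sum fun v _ => ?_
    have : (0 : ℝ) ≤ (u.length * s : ℝ) / n := by positivity
    simp only [hitBound]
    split_ifs <;> linarith
  refine h1.trans ?_
  rw [Finset.sum_add_distrib, ← Finset.sum_filter, Finset.sum_const, Finset.sum_const]
  have h2 : (Finset.univ.filter fun v : Fin n => (v, c) ∈ K₀).card ≤ K₀.card := by
    refine Finset.card_le_card_of_injOn (fun v => (v, c)) (fun v hv => by simpa using hv) ?_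
    intro v _ w _ h
    simpa using h
  have h3 : ((Finset.univ.filter fun v : Fin n => (v, c) ∈ K₀).card : ℝ) ≤ s := by
    exact_mod_cast h2.trans hs
  have h4 : (n : ℝ) * ((u.length * s : ℝ) / n) ≤ u.length * s := by
    rcases Nat.eq_zero_or_pos n with rfl | hn
    · simp; positivity
    · field_simp; exact le_rfl
  simp only [nsmul_eq_mul, mul_one, Finset.card_univ, Fintype.card_fin]
  push_cast
  linarith

lemma condAvg_fmInd_le_hitBound [NeZero n] (K₀ : Finset (Fin n × Bool)) (s : ℕ)
    (hs : K₀.card ≤ s) (u : List Bool) (c : Bool) (hn : (u.length + 1) * s ≤ n)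
    (F : Finset (Fin n)) (K : Finset (Fin n × Bool)) (δ₀ : Fin n × Bool → Fin n) (x y : Fin n)
    (hK : ∀ k ∈ K, k ∈ K₀ ∨ k.1 ∈ F) :
    condAvg K δ₀ (fmInd F (c :: u) x y)
      ≤ 1 / n + hitBound K₀ s (c :: u) x * hitBound K₀ s (c :: u) y := by
  induction u generalizing c F K δ₀ x y with
  | nil =>
    have hpos : 0 ≤ hitBound K₀ s [c] x * hitBound K₀ s [c] y :=
      mul_nonneg (hitBound_nonneg _ _ _ _) (hitBound_nonneg _ _ _ _)
    by_cases h : x ∉ F ∧ y ∉ F ∧ x ≠ y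
    · by_cases hb : (x, c) ∈ K₀ ∧ (y, c) ∈ K₀
      · have h1 : condAvg K δ₀ (fmInd F [c] x y) ≤ 1 := by
          rw [← condAvg_const K δ₀ 1]
          exact condAvg_mono _ _ fun δ _ => fmInd_le_one _ _ _ _ _
        have h2 : (0 : ℝ) ≤ 1 / n := by positivity
        simp only [hitBound, hb.1, hb.2, if_true]
        linarith
      · suffices condAvg K δ₀ (fmInd F [c] x y) ≤ 1 / n by linarith
        have hne : (x, c) ≠ (y, c) := by simp [h.2.2]
        rcases not_and_or.mp hb with hb | hb
        · have := condAvg_eq_le K δ₀ (x, c) (y, c) hne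
            (fun hk => (hK _ hk).elim hb h.1)
          rw [Fintype.card_fin] at this
          refine le_trans (condAvg_mono _ _ fun δ _ => ?_) this
          rw [fmInd_cons_eq h, fmInd_nil]
        · have := condAvg_eq_le K δ₀ (y, c) (x, c) hne.symm
            (fun hk => (hK _ hk).elim hb h.2.1)
          rw [Fintype.card_fin] at this
          refine le_trans (condAvg_mono _ _ fun δ _ => ?_) this
          rw [fmInd_cons_eq h, fmInd_nil]
          simp only [eq_comm (a := δ (x, c))]
          exact le_rfl
    · have : fmInd F [c] x y = fun _ => 0 := funext fun δ => fmInd_cons_eq_zero h _ _ _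
      rw [this, condAvg_const]
      positivity
  | cons c' u ih =>
    by_cases h : x ∉ F ∧ y ∉ F ∧ x ≠ y
    · have hn' : (u.length + 1) * s ≤ n := le_trans (Nat.mul_le_mul_right _ (by simp)) hn
      have hnpos : (0 : ℝ) < n := by exact_mod_cast NeZero.pos n
      have hne : (x, c) ≠ (y, c) := by simp [h.2.2]
      have hle : ∀ v, hitBound K₀ s (c' :: u) v ≤ 1 := fun v =>
        hitBound_le_one _ _ _ _ (by simpa using hn')
      have hone : ∀ z, (∑ v, hitBound K₀ s (c' :: u) v
            ≤ Fintype.card (Fin n) * hitBound K₀ s (c :: c' :: u) z) ∨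
          hitBound K₀ s (c :: c' :: u) z = 1 := by
        intro z
        by_cases hz : (z, c) ∈ K₀
        · right; simp [hitBound, hz]
        · left
          refine (sum_hitBound_le K₀ s hs c' u).trans (le_of_eq ?_)
          simp only [hitBound, hz, if_false, Fintype.card_fin, List.length_cons]
          field_simp
      have hnew : ∀ z, ∑ v, hitBound K₀ s (c' :: u) v
            ≤ Fintype.card (Fin n) * hitBound K₀ s (c :: c' :: u) z := by
        intro z
        rcases hone z with hz | hz
        · exact hz
        · rw [hz, mul_one]
          calc ∑ v, hitBound K₀ s (c' :: u) v ≤ ∑ _v : Fin n, (1 : ℝ) :=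
                Finset.sum_le_sum fun v _ => hle v
            _ = _ := by simp
      have hold : ∀ z, z ∉ F → (z, c) ∈ K → hitBound K₀ s (c :: c' :: u) z = 1 := by
        intro z hz hk
        have : (z, c) ∈ K₀ := (hK _ hk).resolve_right hz
        simp [hitBound, this]
      rw [mul_comm (hitBound K₀ s (c :: c' :: u) x)]
      refine condAvg_le_of_reveal K δ₀ _ (x, c) (1 / n) (hitBound K₀ s (c :: c' :: u) y)
        (hitBound K₀ s (c :: c' :: u) x) (hitBound K₀ s (c' :: u)) (hitBound_nonneg _ _ _ _)
        ?_ (fun hk v => (hle v).trans (hold x h.1 hk).ge) (fun _ => hnew x)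
      intro δ₁ _ _
      rw [mul_comm (hitBound K₀ s (c :: c' :: u) y)]
      refine condAvg_le_of_reveal _ δ₁ _ (y, c) (1 / n) (hitBound K₀ s (c' :: u) (δ₁ (x, c)))
        (hitBound K₀ s (c :: c' :: u) y) (hitBound K₀ s (c' :: u)) (hitBound_nonneg _ _ _ _)
        ?_ (fun hk v => (hle v).trans (hold y h.2.1 ?_).ge) (fun _ => hnew y)
      · intro δ₂ h2 _
        rw [← h2 (x, c) (by simp)]
        refine le_trans (condAvg_mono _ _ (g := fmInd (insert x (insert y F)) (c' :: u)
          (δ₂ (x, c)) (δ₂ (y, c))) fun δ hδ => ?_) (ih c' hn' _ _ δ₂ _ _ ?_)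
        · rw [fmInd_cons_eq h, hδ (x, c) (by simp), hδ (y, c) (by simp)]
        · intro k hk
          simp only [Finset.mem_insert] at hk
          rcases hk with rfl | rfl | hk
          · simp
          · simp
          · rcases hK k hk with hk | hk <;> simp [hk]
      · simpa [hne.symm, h.2.2.symm] using hk
    · have : fmInd F (c :: c' :: u) x y = fun _ => 0 := funext fun δ => fmInd_cons_eq_zero h _ _ _
      rw [this, condAvg_const]
      have := mul_nonneg (hitBound_nonneg K₀ s (c :: c' :: u) x)
        (hitBound_nonneg K₀ s (c :: c' :: u) y)
      positivity

lemma forall_fst_mem_insert {F : Finset (Fin n)} {K : Finset (Fin n × Bool)}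
    (hK : ∀ k ∈ K, k.1 ∈ F) (x y : Fin n) (c : Bool) :
    ∀ k ∈ insert (y, c) (insert (x, c) K), k.1 ∈ insert x (insert y F) := by
  intro k hk
  simp only [Finset.mem_insert] at hk
  rcases hk with rfl | rfl | hk
  · simp
  · simp
  · simp [hK k hk]

lemma card_insert_insert_le_add {α : Type*} [DecidableEq α] (a b : α) (K : Finset α) :
    (insert a (insert b K)).card ≤ K.card + 2 :=
  (Finset.card_insert_le _ _).trans (by have := Finset.card_insert_le b K; omega)

/-- The merging of a fresh pair of trajectories costs a factor `1 / n`, even jointly with an event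
whose conditional probability is bounded as long as few keys are revealed, none of them in `R`. -/
lemma condAvg_fmInd_mul_le [NeZero n] (g : (Fin n × Bool → Fin n) → ℝ) (hg : ∀ δ, 0 ≤ g δ)
    (B : ℝ) (hB : 0 ≤ B) (R : Finset (Fin n × Bool)) (s : ℕ)
    (hgB : ∀ K δ₀, K.card ≤ s → (∀ k ∈ R, k ∉ K) → condAvg K δ₀ g ≤ B)
    (v : List Bool) (c : Bool) (F : Finset (Fin n)) (K : Finset (Fin n × Bool))
    (δ₀ : Fin n × Bool → Fin n) (x y : Fin n) (hK : ∀ k ∈ K, k.1 ∈ F)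
    (hs : K.card + 2 * (v.length + 1) ≤ s) (hRK : ∀ k ∈ R, k ∉ K)
    (hR : ∀ k ∈ R, k.1 ∈ F ∨ (k ≠ (x, c) ∧ k ≠ (y, c) ∧ (k.1 = x ∨ k.1 = y))) :
    condAvg K δ₀ (fun δ => fmInd F (c :: v) x y δ * g δ) ≤ 1 / n * B := by
  have hnpos : (0 : ℝ) < n := by exact_mod_cast NeZero.pos n
  induction v generalizing c F K δ₀ x y with
  | nil =>
    by_cases h : x ∉ F ∧ y ∉ F ∧ x ≠ y
    · have hne : (y, c) ≠ (x, c) := by simp [h.2.2.symm]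
      have hyK : (y, c) ∉ insert (x, c) K := by
        simp only [Finset.mem_insert, hne, false_or]
        exact fun hk => h.2.1 (hK _ hk)
      have hRK' : ∀ k ∈ R, k ∉ insert (y, c) (insert (x, c) K) := by
        intro k hk
        simp only [Finset.mem_insert, not_or]
        refine ⟨?_, ?_, hRK k hk⟩
        · rcases hR k hk with hF | hF
          · rintro rfl; exact h.2.1 hF
          · exact hF.2.1
        · rcases hR k hk with hF | hF
          · rintro rfl; exact h.1 hF
          · exact hF.1
      have hx : ∀ δ₁, condAvg (insert (x, c) K) δ₁ (fun δ => fmInd F [c] x y δ * g δ)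
          ≤ 0 + B * (1 / n) := by
        intro δ₁
        refine condAvg_le_of_reveal _ δ₁ _ (y, c) 0 B (1 / n)
          (fun v => if δ₁ (x, c) = v then 1 else 0) hB ?_ (fun hk => absurd hk hyK) ?_
        · intro δ₂ h2 _
          have e2 := h2 (x, c) (by simp)
          by_cases e : δ₁ (x, c) = δ₂ (y, c)
          · simp only [e, if_true, zero_add, mul_one]
            refine (condAvg_mono _ _ fun δ _ => ?_).trans
              (hgB _ δ₂ ((card_insert_insert_le_add _ _ _).trans (by simpa using hs)) hRK')
            exact mul_le_of_le_one_left (hg δ) (fmInd_le_one _ _ _ _ _)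
          · simp only [e, if_false, mul_zero, zero_add]
            rw [← condAvg_const (insert (y, c) (insert (x, c) K)) δ₂ 0]
            refine condAvg_mono _ _ fun δ hδ => ?_
            rw [fmInd_cons_eq h, fmInd_nil, hδ (x, c) (by simp), hδ (y, c) (by simp), e2]
            simp [e]
        · intro _
          simp [hnpos.ne']
      have := condAvg_le_of_reveal K δ₀ (fun δ => fmInd F [c] x y δ * g δ) (x, c)
        (0 + B * (1 / n)) 0 0 (fun _ => 0) le_rfl (fun δ₁ _ _ => by simpa using hx δ₁)
        (by simp) (by simp)
      linarith
    · simp only [fmInd_cons_eq_zero h, zero_mul, condAvg_const]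
      positivity
  | cons c' v ih =>
    by_cases h : x ∉ F ∧ y ∉ F ∧ x ≠ y
    · refine condAvg_le_of_forall_reveal_pair K δ₀ _ (x, c) (y, c) _ fun δ₂ => ?_
      refine le_trans (condAvg_mono _ _ (g := fun δ => fmInd (insert x (insert y F)) (c' :: v)
          (δ₂ (x, c)) (δ₂ (y, c)) δ * g δ) fun δ hδ => ?_)
        (ih c' _ _ δ₂ _ _ (forall_fst_mem_insert hK x y c) ?_ ?_ ?_)
      · rw [fmInd_cons_eq h, hδ (x, c) (by simp), hδ (y, c) (by simp)]
      · have := card_insert_insert_le_add (y, c) (x, c) K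
        simp only [List.length_cons] at hs
        omega
      · intro k hk
        simp only [Finset.mem_insert, not_or]
        refine ⟨?_, ?_, hRK k hk⟩
        · rcases hR k hk with hF | hF
          · rintro rfl; exact h.2.1 hF
          · exact hF.2.1
        · rcases hR k hk with hF | hF
          · rintro rfl; exact h.1 hF
          · exact hF.1
      · intro k hk
        left
        rcases hR k hk with hF | ⟨_, _, hF | hF⟩ <;> simp [hF]
    · simp only [fmInd_cons_eq_zero h, zero_mul, condAvg_const]
      positivity

lemma condAvg_fmInd_le [NeZero n] (δ₀ : Fin n × Bool → Fin n) (c : Bool) (v : List Bool)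
    (x y : Fin n) : condAvg ∅ δ₀ (fmInd ∅ (c :: v) x y) ≤ 1 / n := by
  have := condAvg_fmInd_mul_le (n := n) (fun _ => 1) (fun _ => zero_le_one) 1 zero_le_one ∅
    (2 * (v.length + 1)) (fun K δ₁ _ _ => (condAvg_const K δ₁ 1).le) v c ∅ ∅ δ₀ x y
    (by simp) (by simp) (by simp) (by simp)
  simpa using this

lemma condAvg_fmInd_mul_fmInd_le [NeZero n] (t s : ℕ) (hts : t * s ≤ n) (w w' : List Bool)
    (hne : w ≠ w') (hlen : w.length = w'.length) (hwt : w.length ≤ t)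
    (F : Finset (Fin n)) (K : Finset (Fin n × Bool)) (δ₀ : Fin n × Bool → Fin n) (x y : Fin n)
    (hK : ∀ k ∈ K, k.1 ∈ F) (hs : K.card + 2 * w.length ≤ s) :
    condAvg K δ₀ (fun δ => fmInd F w x y δ * fmInd F w' x y δ)
      ≤ 1 / n * (1 / n + ((t * s : ℝ) / n) ^ 2) := by
  induction w generalizing w' F K δ₀ x y with
  | nil => exact absurd (List.length_eq_zero_iff.mp hlen.symm).symm hne
  | cons c v ih =>
    cases w' with
    | nil => simp at hlen
    | cons c' u =>
      simp only [List.length_cons, Nat.add_right_cancel_iff] at hlen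
      simp only [List.length_cons] at hwt hs
      by_cases h : x ∉ F ∧ y ∉ F ∧ x ≠ y
      swap
      · simp only [fmInd_cons_eq_zero h, zero_mul, condAvg_const]
        positivity
      by_cases hc : c = c'
      · subst hc
        refine condAvg_le_of_forall_reveal_pair K δ₀ _ (x, c) (y, c) _ fun δ₂ => ?_
        refine le_trans (condAvg_mono _ _ (g := fun δ =>
            fmInd (insert x (insert y F)) v (δ₂ (x, c)) (δ₂ (y, c)) δ *
            fmInd (insert x (insert y F)) u (δ₂ (x, c)) (δ₂ (y, c)) δ) fun δ hδ => ?_)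
          (ih u (by simpa using hne) hlen (by omega) _ _ δ₂ _ _
            (forall_fst_mem_insert hK x y c) ?_)
        · rw [fmInd_cons_eq h, fmInd_cons_eq h, hδ (x, c) (by simp), hδ (y, c) (by simp)]
        · have := card_insert_insert_le_add (y, c) (x, c) K
          omega
      · refine condAvg_fmInd_mul_le (fmInd F (c' :: u) x y) (fmInd_nonneg _ _ _ _) _
          (by positivity) {(x, c'), (y, c')} s ?_ v c F K δ₀ x y hK (by omega) ?_ ?_
        · intro K₁ δ₁ hcard hR
          have hx : (x, c') ∉ K₁ := hR _ (by simp)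
          have hy : (y, c') ∉ K₁ := hR _ (by simp)
          have hut : u.length + 1 ≤ t := by omega
          have := condAvg_fmInd_le_hitBound K₁ s hcard u c'
            ((Nat.mul_le_mul_right _ hut).trans hts) F K₁ δ₁ x y (fun k hk => Or.inl hk)
          refine this.trans ?_
          simp only [hitBound, hx, hy, if_false]
          have hle : (u.length : ℝ) ≤ t := by exact_mod_cast (Nat.le_succ _).trans hut
          rw [← pow_two]
          gcongr
        · intro k hk hkK
          have := hK k hkK
          simp only [Finset.mem_insert, Finset.mem_singleton] at hk
          rcases hk with rfl | rfl
          · exact h.1 this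
          · exact h.2.1 this
        · intro k hk
          right
          simp only [Finset.mem_insert, Finset.mem_singleton] at hk
          rcases hk with rfl | rfl <;> simp [Ne.symm hc]

lemma sum_neg_indicator_compl_le [NeZero n] (S : Finset (Fin n)) (s : ℕ) (hS : S.card ≤ s) :
    ∑ v : Fin n, -(if v ∉ S then (1 : ℝ) else 0)
      ≤ Fintype.card (Fin n) * -(1 - (s : ℝ) / n) := by
  have hnpos : (0 : ℝ) < n := by exact_mod_cast NeZero.pos n
  have h1 : ∑ v : Fin n, (if v ∉ S then (1 : ℝ) else 0) = n - S.card := by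
    have h2 : ∀ v : Fin n, (if v ∉ S then (1 : ℝ) else 0) = 1 - if v ∈ S then 1 else 0 := by
      intro v; by_cases h : v ∈ S <;> simp [h]
    simp_rw [h2]
    rw [Finset.sum_sub_distrib]
    simp
  rw [Finset.sum_neg_distrib, h1, Fintype.card_fin]
  have h3 : (S.card : ℝ) ≤ s := by exact_mod_cast hS
  have h4 : (n : ℝ) * -(1 - (s : ℝ) / n) = s - n := by field_simp; ring
  linarith

lemma condAvg_neg_fmInd_le [NeZero n] (s : ℕ) (u : List Bool) (c : Bool)
    (hn : u.length * (2 * s + 1) ≤ n)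
    (F : Finset (Fin n)) (K : Finset (Fin n × Bool)) (δ₀ : Fin n × Bool → Fin n) (x y : Fin n)
    (hK : ∀ k ∈ K, k.1 ∈ F) (hx : x ∉ F) (hy : y ∉ F) (hxy : x ≠ y)
    (hs : F.card + 2 * (u.length + 1) ≤ s) :
    condAvg K δ₀ (fun δ => -fmInd F (c :: u) x y δ)
      ≤ -(1 / n * (1 - u.length * (2 * s + 1) / n)) := by
  have hnpos : (0 : ℝ) < n := by exact_mod_cast NeZero.pos n
  induction u generalizing c F K δ₀ x y with
  | nil =>
    have hne : (y, c) ≠ (x, c) := by simp [hxy.symm]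
    have hyK : (y, c) ∉ insert (x, c) K := by
      simp only [Finset.mem_insert, hne, false_or]
      exact fun hk => hy (hK _ hk)
    have hx1 : ∀ δ₁, condAvg (insert (x, c) K) δ₁ (fun δ => -fmInd F [c] x y δ)
        ≤ 0 + 1 * (-(1 / n) : ℝ) := by
      intro δ₁
      refine condAvg_le_of_reveal _ δ₁ _ (y, c) 0 1 (-(1 / n))
        (fun v => -(if δ₁ (x, c) = v then 1 else 0)) zero_le_one ?_
        (fun hk => absurd hk hyK) ?_
      · intro δ₂ h2 _
        have e2 := h2 (x, c) (by simp)
        rw [zero_add, one_mul,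
          ← condAvg_const (insert (y, c) (insert (x, c) K)) δ₂
            (-(if δ₁ (x, c) = δ₂ (y, c) then (1 : ℝ) else 0))]
        refine condAvg_mono _ _ fun δ hδ => ?_
        rw [fmInd_cons_eq ⟨hx, hy, hxy⟩, fmInd_nil, hδ (x, c) (by simp), hδ (y, c) (by simp), e2]
      · intro _
        simp [hnpos.ne']
    have := condAvg_le_of_reveal K δ₀ (fun δ => -fmInd F [c] x y δ) (x, c)
      (0 + 1 * (-(1 / n))) 0 0 (fun _ => 0) le_rfl (fun δ₁ _ _ => by simpa using hx1 δ₁)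
      (by simp) (by simp)
    simpa using this
  | cons c' u ih =>
    simp only [List.length_cons] at hn hs
    have hn' : u.length * (2 * s + 1) ≤ n := (Nat.mul_le_mul_right _ (Nat.le_succ _)).trans hn
    have hs1 : s + 1 ≤ n := by nlinarith
    have hs1' : ((s + 1 : ℕ) : ℝ) / n ≤ 1 := by
      rw [div_le_one hnpos]; exact_mod_cast hs1
    set L : ℝ := 1 / n * (1 - u.length * (2 * s + 1) / n) with hL
    have hL0 : 0 ≤ L := by
      have : (u.length * (2 * s + 1) : ℝ) / n ≤ 1 := by
        rw [div_le_one hnpos]; exact_mod_cast hn'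
      rw [hL]
      exact mul_nonneg (by positivity) (by linarith)
    have hne : (y, c) ≠ (x, c) := by simp [hxy.symm]
    have hxK : (x, c) ∉ K := fun hk => hx (hK _ hk)
    have hyK : (y, c) ∉ insert (x, c) K := by
      simp only [Finset.mem_insert, hne, false_or]
      exact fun hk => hy (hK _ hk)
    set F' := insert x (insert y F) with hF'
    have hcard : F'.card ≤ F.card + 2 := card_insert_insert_le_add _ _ _
    have main : condAvg K δ₀ (fun δ => -fmInd F (c :: c' :: u) x y δ)
        ≤ 0 + L * (1 - ((s + 1 : ℕ) : ℝ) / n) * -(1 - (s : ℝ) / n) := by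
      refine condAvg_le_of_reveal K δ₀ _ (x, c) 0 _ _ (fun v => -(if v ∉ F' then 1 else 0))
        (mul_nonneg hL0 (by linarith)) ?_ (fun hk => absurd hk hxK)
        (fun _ => sum_neg_indicator_compl_le F' s (by omega))
      intro δ₁ _ _
      have h2 : condAvg (insert (x, c) K) δ₁ (fun δ => -fmInd F (c :: c' :: u) x y δ)
          ≤ 0 + (L * if δ₁ (x, c) ∉ F' then 1 else 0) * -(1 - ((s + 1 : ℕ) : ℝ) / n) := by
        refine condAvg_le_of_reveal _ δ₁ _ (y, c) 0 _ _
          (fun v => -(if v ∉ insert (δ₁ (x, c)) F' then 1 else 0))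
          (mul_nonneg hL0 (by split_ifs <;> norm_num)) ?_ (fun hk => absurd hk hyK)
          (fun _ => sum_neg_indicator_compl_le _ (s + 1)
            ((Finset.card_insert_le _ _).trans (by omega)))
        intro δ₂ hδ₂ _
        have e2 := hδ₂ (x, c) (by simp)
        by_cases hgood : δ₁ (x, c) ∉ F' ∧ δ₂ (y, c) ∉ insert (δ₁ (x, c)) F'
        · have h3 := hgood.2
          simp only [Finset.mem_insert, not_or] at h3
          rw [if_pos hgood.1, if_pos hgood.2]
          have := ih c' hn' F' (insert (y, c) (insert (x, c) K)) δ₂ (δ₂ (x, c)) (δ₂ (y, c))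
            (forall_fst_mem_insert hK x y c) (by rw [e2]; exact hgood.1) h3.2
            (by rw [e2]; exact Ne.symm h3.1) (by omega)
          refine le_trans (condAvg_mono _ _ fun δ hδ => ?_) (this.trans (le_of_eq (by ring)))
          rw [fmInd_cons_eq ⟨hx, hy, hxy⟩, hδ (x, c) (by simp), hδ (y, c) (by simp)]
        · have hz : (0 : ℝ) + (L * if δ₁ (x, c) ∉ F' then 1 else 0) *
              -(if δ₂ (y, c) ∉ insert (δ₁ (x, c)) F' then 1 else 0) = 0 := by
            rcases not_and_or.mp hgood with h | h <;> simp only [h, if_false] <;> ring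
          rw [hz, ← condAvg_const (insert (y, c) (insert (x, c) K)) δ₂ 0]
          exact condAvg_mono _ _ fun δ _ => neg_nonpos.mpr (fmInd_nonneg _ _ _ _ _)
      exact h2.trans (le_of_eq (by ring))
    refine main.trans ?_
    have hsum : (1 - (u.length * (2 * s + 1) : ℝ) / n) *
        ((1 - ((s + 1 : ℕ) : ℝ) / n) * (1 - (s : ℝ) / n))
          ≥ 1 - ((u.length + 1 : ℕ) * (2 * s + 1) : ℝ) / n := by
      have ha : 0 ≤ (u.length * (2 * s + 1) : ℝ) / n := by positivity
      have hb : 0 ≤ (s : ℝ) / n := by positivity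
      have hb2 : 0 ≤ (1 : ℝ) / n := by positivity
      have e1 : ((s + 1 : ℕ) : ℝ) / n = s / n + 1 / n := by push_cast; ring
      have e2 : ((u.length + 1 : ℕ) * (2 * s + 1) : ℝ) / n
          = (u.length * (2 * s + 1) : ℝ) / n + 2 * (s / n) + 1 / n := by push_cast; ring
      have ha1 : (u.length * (2 * s + 1) : ℝ) / n ≤ 1 := by
        rw [div_le_one hnpos]; exact_mod_cast hn'
      rw [e1] at hs1' ⊢
      rw [e2]
      generalize (u.length * (2 * s + 1) : ℝ) / n = a at *
      generalize (s : ℝ) / n = p at *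
      generalize (1 : ℝ) / n = r at *
      have h1 : (1 - (p + r)) * (1 - p) ≥ 1 - (2 * p + r) := by nlinarith
      have h2 : (1 - a) * ((1 - (p + r)) * (1 - p)) ≥ (1 - a) * (1 - (2 * p + r)) :=
        mul_le_mul_of_nonneg_left h1 (by linarith)
      nlinarith
    have h5 := mul_le_mul_of_nonneg_left hsum.le (by positivity : (0 : ℝ) ≤ 1 / n)
    rw [hL]
    simp only [List.length_cons]
    linarith

end Bounds

section Colors

lemma sum_prod_color {κ : Type*} [Fintype κ] [DecidableEq κ] (q : ℝ) (S : Finset κ) :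
    ∑ col : κ → Bool, (∏ k, if col k then q else 1 - q) *
      (if ∀ k ∈ S, col k = false then 1 else 0) = (1 - q) ^ S.card := by
  have h1 : ∀ col : κ → Bool, (∏ k, if col k then q else 1 - q) *
      (if ∀ k ∈ S, col k = false then (1 : ℝ) else 0)
        = ∏ k, (if col k then q else 1 - q) * (if k ∈ S → col k = false then 1 else 0) := by
    intro col
    rw [Finset.prod_mul_distrib, Finset.prod_boole]
    simp
  have h2 : ∏ k : κ, ∑ b : Bool, ((if b then q else 1 - q) *
      (if k ∈ S → b = false then (1 : ℝ) else 0)) = (1 - q) ^ S.card := by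
    rw [← Finset.prod_const, ← Finset.prod_subset (Finset.subset_univ S)]
    · exact Finset.prod_congr rfl fun k hk => by simp [hk]
    · intro k _ hk; simp [hk]
  rw [← h2, Finset.prod_univ_sum, Fintype.piFinset_univ]
  exact Finset.sum_congr rfl fun col _ => h1 col

lemma sum_prod_color_eq_one {κ : Type*} [Fintype κ] [DecidableEq κ] (q : ℝ) :
    ∑ col : κ → Bool, (∏ k, if col k then q else 1 - q) = 1 := by
  simpa using sum_prod_color q (∅ : Finset κ)

lemma usedPairs_length {n : ℕ} (δ : Fin n × Bool → Fin n) (w : List Bool) (x : Fin n) :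
    (usedPairs δ w x).length = w.length := by
  induction w generalizing x with
  | nil => rfl
  | cons c w ih => simp [usedPairs, ih]

lemma one_sub_le_sum_blue {n : ℕ} (q : ℝ) (hq0 : 0 ≤ q) (hq1 : q ≤ 1)
    (δ : Fin n × Bool → Fin n) (w : List Bool) (x y : Fin n) :
    1 - 2 * w.length * q ≤ ∑ col : Fin n × Bool → Bool, (∏ k, if col k then q else 1 - q) *
      (if ∀ k ∈ usedPairs δ w x ++ usedPairs δ w y, col k = false then (1 : ℝ) else 0) := by
  have h := sum_prod_color q (usedPairs δ w x ++ usedPairs δ w y).toFinset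
  simp only [List.mem_toFinset] at h
  have hc : (usedPairs δ w x ++ usedPairs δ w y).toFinset.card ≤ 2 * w.length := by
    refine (List.toFinset_card_le _).trans ?_
    simp [usedPairs_length]
    omega
  have h3 : ((usedPairs δ w x ++ usedPairs δ w y).toFinset.card : ℝ) ≤ 2 * w.length := by
    exact_mod_cast hc
  have h2 := one_add_mul_le_pow (a := -q) (by linarith)
    (usedPairs δ w x ++ usedPairs δ w y).toFinset.card
  calc 1 - 2 * w.length * q
      ≤ 1 + (usedPairs δ w x ++ usedPairs δ w y).toFinset.card * -q := by nlinarith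
    _ ≤ (1 - q) ^ (usedPairs δ w x ++ usedPairs δ w y).toFinset.card := by
        simpa [sub_eq_add_neg] using h2
    _ = _ := by
        rw [← h]

end Colors

section SecondMoment

variable {n : ℕ}

/-- The number of words of length `t` merging `x` and `y` along fresh trajectories. -/
noncomputable def freshCount (t : ℕ) (x y : Fin n) (δ : Fin n × Bool → Fin n) : ℝ :=
  ∑ w : List.Vector Bool t, fmInd ∅ w.toList x y δ

lemma sum_color_mem_Lb_le (q : ℝ) (hq0 : 0 ≤ q) (hq1 : q ≤ 1) (t : ℕ)
    (ht : (t : ℝ) ≤ 2 * Real.logb 2 n) (m : ℝ) (hm : 0 < m) (x y : Fin n)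
    (δ : Fin n × Bool → Fin n) :
    ∑ col : Fin n × Bool → Bool, (∏ k, if col k then q else 1 - q) *
        (if (x, y) ∈ Lb n δ col then (1 : ℝ) else 0)
      ≤ (freshCount t x y δ ^ 2 - 2 * m * (1 - 2 * t * q) * freshCount t x y δ + m ^ 2)
          / m ^ 2 := by
  set W : (Fin n × Bool → Bool) → ℝ := fun col => ∏ k, if col k then q else 1 - q with hW
  have hW0 : ∀ col, 0 ≤ W col := fun col => Finset.prod_nonneg fun k _ => by
    split_ifs <;> linarith
  have hW1 : ∑ col, W col = 1 := sum_prod_color_eq_one q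
  set N : (Fin n × Bool → Bool) → ℝ := fun col => ∑ w : List.Vector Bool t,
    fmInd ∅ w.toList x y δ *
      (if ∀ k ∈ usedPairs δ w.toList x ++ usedPairs δ w.toList y, col k = false
        then (1 : ℝ) else 0) with hN
  have hN0 : ∀ col, 0 ≤ N col := fun col => Finset.sum_nonneg fun w _ =>
    mul_nonneg (fmInd_nonneg _ _ _ _ _) (by split_ifs <;> norm_num)
  have hNle : ∀ col, N col ≤ freshCount t x y δ := fun col => Finset.sum_le_sum fun w _ =>
    mul_le_of_le_one_right (fmInd_nonneg _ _ _ _ _) (by split_ifs <;> norm_num)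
  have hNmean : (1 - 2 * t * q) * freshCount t x y δ ≤ ∑ col, W col * N col := by
    simp only [hN, Finset.mul_sum]
    rw [Finset.sum_comm, freshCount, Finset.mul_sum]
    refine Finset.sum_le_sum fun w _ => ?_
    have h := one_sub_le_sum_blue q hq0 hq1 δ w.toList x y
    rw [List.Vector.toList_length] at h
    calc (1 - 2 * t * q) * fmInd ∅ w.toList x y δ
        ≤ _ := mul_le_mul_of_nonneg_right h (fmInd_nonneg _ _ _ _ _)
      _ = _ := by
        rw [Finset.sum_mul]
        exact Finset.sum_congr rfl fun col _ => by ring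
  have hind : ∀ col, (if (x, y) ∈ Lb n δ col then (1 : ℝ) else 0) * m ^ 2
      ≤ freshCount t x y δ ^ 2 - 2 * m * N col + m ^ 2 := by
    intro col
    have hsq : N col ^ 2 ≤ freshCount t x y δ ^ 2 := pow_le_pow_left₀ (hN0 col) (hNle col) 2
    by_cases h : (x, y) ∈ Lb n δ col
    · have hz : N col = 0 := by
        refine Finset.sum_eq_zero fun w _ => ?_
        by_contra hne
        have h1 := left_ne_zero_of_mul hne
        have h2 := right_ne_zero_of_mul hne
        have h1' : FreshMerge δ ∅ w.toList x y := by
          by_contra hf; exact h1 (by simp [fmInd, hf])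
        have h2' : ∀ k ∈ usedPairs δ w.toList x ++ usedPairs δ w.toList y, col k = false := by
          by_contra hf; exact h2 (if_neg hf)
        simp only [Lb, Finset.mem_filter, Finset.mem_univ, true_and] at h
        exact h ⟨w.toList, by rw [List.Vector.toList_length]; exact ht, h1'.run_eq, h2'⟩
      rw [if_pos h, hz]
      have := sq_nonneg (freshCount t x y δ)
      linarith
    · rw [if_neg h]
      nlinarith [sq_nonneg (N col - m)]
  rw [le_div_iff₀ (by positivity), Finset.sum_mul]
  calc ∑ col, W col * (if (x, y) ∈ Lb n δ col then (1 : ℝ) else 0) * m ^ 2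
      ≤ ∑ col, (W col * (freshCount t x y δ ^ 2 + m ^ 2) - 2 * m * (W col * N col)) := by
        refine Finset.sum_le_sum fun col _ => ?_
        have := mul_le_mul_of_nonneg_left (hind col) (hW0 col)
        nlinarith
    _ = (freshCount t x y δ ^ 2 + m ^ 2) - 2 * m * ∑ col, W col * N col := by
        rw [Finset.sum_sub_distrib, ← Finset.sum_mul, hW1, one_mul, ← Finset.mul_sum]
    _ ≤ _ := by
        have := mul_le_mul_of_nonneg_left hNmean (by positivity : 0 ≤ 2 * m)
        linarith

lemma condAvg_sum {κ V ι : Type*} [Fintype κ] [Fintype V] [DecidableEq κ] (K : Finset κ)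
    (δ₀ : κ → V) (I : Finset ι) (f : ι → (κ → V) → ℝ) :
    condAvg K δ₀ (fun δ => ∑ i ∈ I, f i δ) = ∑ i ∈ I, condAvg K δ₀ (f i) := by
  unfold condAvg
  rw [Finset.sum_comm, Finset.sum_div]

lemma condAvg_freshCount_sq_le [NeZero n] (δ₀ : Fin n × Bool → Fin n) (t : ℕ) (ht0 : 0 < t)
    (ht : t * (2 * t) ≤ n) (x y : Fin n) :
    condAvg ∅ δ₀ (fun δ => freshCount t x y δ ^ 2)
      ≤ 2 ^ t / n + (2 ^ t / n) ^ 2 * (1 + 4 * t ^ 4 / n) := by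
  have hnpos : (0 : ℝ) < n := by exact_mod_cast NeZero.pos n
  set B : ℝ := 1 / n * (1 / n + ((t * (2 * t : ℕ) : ℝ) / n) ^ 2) with hB
  have hB0 : 0 ≤ B := by positivity
  have hcard : (Fintype.card (List.Vector Bool t) : ℝ) = 2 ^ t := by simp
  simp only [freshCount, pow_two, Finset.sum_mul_sum]
  rw [condAvg_sum]
  simp only [condAvg_sum]
  calc ∑ w : List.Vector Bool t, ∑ w' : List.Vector Bool t, condAvg ∅ δ₀
          (fun δ => fmInd ∅ w.toList x y δ * fmInd ∅ w'.toList x y δ)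
      ≤ ∑ w : List.Vector Bool t, ∑ w' : List.Vector Bool t,
          ((if w = w' then 1 / (n : ℝ) else 0) + B) := by
        refine Finset.sum_le_sum fun w _ => Finset.sum_le_sum fun w' _ => ?_
        by_cases h : w = w'
        · subst h
          rw [if_pos rfl]
          have hlen := w.toList_length
          have h1 : condAvg ∅ δ₀ (fun δ => fmInd ∅ w.toList x y δ * fmInd ∅ w.toList x y δ)
              ≤ condAvg ∅ δ₀ (fmInd ∅ w.toList x y) :=
            condAvg_mono _ _ fun δ _ =>
              mul_le_of_le_one_left (fmInd_nonneg _ _ _ _ _) (fmInd_le_one _ _ _ _ _)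
          cases hw : w.toList with
          | nil => rw [hw] at hlen; simp at hlen; omega
          | cons c v =>
            rw [hw] at h1
            have h2 := condAvg_fmInd_le δ₀ c v x y
            linarith
        · rw [if_neg h, zero_add]
          exact condAvg_fmInd_mul_fmInd_le t (2 * t) ht w.toList w'.toList
            (fun e => h (Subtype.ext e)) (by simp) (by simp) ∅ ∅ δ₀ x y (by simp) (by simp)
    _ = 2 ^ t * (1 / n + 2 ^ t * B) := by
        simp only [Finset.sum_add_distrib, Finset.sum_ite_eq, Finset.mem_univ, if_true,
          Finset.sum_const, Finset.card_univ, nsmul_eq_mul, hcard]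
        ring
    _ = _ := by
        rw [hB]
        push_cast
        field_simp
        ring

lemma le_condAvg_freshCount [NeZero n] (δ₀ : Fin n × Bool → Fin n) (t : ℕ) (ht0 : 0 < t)
    (ht : t * (4 * t + 1) ≤ n) (x y : Fin n) (hxy : x ≠ y) :
    2 ^ t / n * (1 - t * (4 * t + 1) / n) ≤ condAvg ∅ δ₀ (freshCount t x y) := by
  have hnpos : (0 : ℝ) < n := by exact_mod_cast NeZero.pos n
  have hcard : (Fintype.card (List.Vector Bool t) : ℝ) = 2 ^ t := by simp
  have h0 : condAvg ∅ δ₀ (freshCount t x y)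
      = ∑ w : List.Vector Bool t, condAvg ∅ δ₀ (fmInd ∅ w.toList x y) := by
    rw [← condAvg_sum]; rfl
  rw [h0]
  calc (2 : ℝ) ^ t / n * (1 - t * (4 * t + 1) / n)
      = ∑ _w : List.Vector Bool t, (1 / n * (1 - t * (4 * t + 1) / n) : ℝ) := by
        rw [Finset.sum_const, Finset.card_univ, nsmul_eq_mul, hcard]; ring
    _ ≤ _ := by
        refine Finset.sum_le_sum fun w _ => ?_
        have hlen := w.toList_length
        cases hw : w.toList with
        | nil => rw [hw] at hlen; simp at hlen; omega
        | cons c v =>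
          rw [hw, List.length_cons] at hlen
          have hv : v.length ≤ t := by omega
          have h1 := condAvg_neg_fmInd_le (2 * t) v c
            ((Nat.mul_le_mul_right _ hv).trans (by linarith)) ∅ ∅ δ₀ x y
            (by simp) (by simp) (by simp) hxy (by simp; omega)
          have h2 : condAvg ∅ δ₀ (fun δ => -fmInd ∅ (c :: v) x y δ)
              = -condAvg ∅ δ₀ (fmInd ∅ (c :: v) x y) := by
            simp [condAvg, neg_div]
          rw [h2] at h1
          have hv' : (v.length : ℝ) ≤ t := by exact_mod_cast hv
          have h3 : (1 / n * (1 - t * (4 * t + 1) / n) : ℝ)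
              ≤ 1 / n * (1 - v.length * (2 * (2 * t : ℕ) + 1) / n) := by
            push_cast
            have e : (2 : ℝ) * (2 * t) = 4 * t := by ring
            rw [e]
            gcongr
          linarith

/-- A bound for the probability that a given pair of distinct states cannot be merged by a short
blue word. -/
noncomputable def failBound (n t : ℕ) (q : ℝ) : ℝ :=
  n / 2 ^ t + 4 * t ^ 4 / n + 4 * t * q + 2 * (t * (4 * t + 1) / n)

lemma prob_mem_Lb_le [NeZero n] (q : ℝ) (hq0 : 0 ≤ q) (hq1 : q ≤ 1) (t : ℕ) (ht0 : 0 < t)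
    (ht : (t : ℝ) ≤ 2 * Real.logb 2 n) (htn : t * (4 * t + 1) ≤ n) (htq : 2 * t * q ≤ 1)
    (x y : Fin n) :
    ∑ δ : Fin n × Bool → Fin n, ∑ col : Fin n × Bool → Bool,
        ((1 / (n : ℝ) ^ (2 * n)) * ∏ k, if col k then q else 1 - q) *
        (if (x, y) ∈ Lb n δ col then (1 : ℝ) else 0) ≤ failBound n t q := by
  have hnpos : (0 : ℝ) < n := by exact_mod_cast NeZero.pos n
  by_cases hxy : x = y
  · have h0 : ∀ δ col, (x, y) ∉ Lb n δ col := by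
      intro δ col h
      simp only [Lb, Finset.mem_filter, Finset.mem_univ, true_and] at h
      refine h ⟨[], ?_, by simp [run, hxy], by simp [usedPairs]⟩
      simpa using (Nat.cast_nonneg t).trans ht
    simp only [h0, if_false, mul_zero, Finset.sum_const_zero]
    unfold failBound
    positivity
  have δ₀ : Fin n × Bool → Fin n := fun _ => x
  set m : ℝ := 2 ^ t / n with hm
  have hmpos : 0 < m := by positivity
  have hcard : (Fintype.card (Fin n × Bool → Fin n) : ℝ) = (n : ℝ) ^ (2 * n) := by
    simp [mul_comm]
  have step : ∑ δ : Fin n × Bool → Fin n, ∑ col : Fin n × Bool → Bool,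
        ((1 / (n : ℝ) ^ (2 * n)) * ∏ k, if col k then q else 1 - q) *
        (if (x, y) ∈ Lb n δ col then (1 : ℝ) else 0)
      ≤ (condAvg ∅ δ₀ (fun δ => freshCount t x y δ ^ 2)
          - 2 * m * (1 - 2 * t * q) * condAvg ∅ δ₀ (freshCount t x y) + m ^ 2) / m ^ 2 := by
    have hconst := condAvg_const (∅ : Finset (Fin n × Bool)) δ₀ (m ^ 2)
    calc _ = (∑ δ : Fin n × Bool → Fin n, ∑ col : Fin n × Bool → Bool,
              (∏ k, if col k then q else 1 - q) *
              (if (x, y) ∈ Lb n δ col then (1 : ℝ) else 0)) / (n : ℝ) ^ (2 * n) := by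
          rw [Finset.sum_div]
          refine Finset.sum_congr rfl fun δ _ => ?_
          rw [Finset.sum_div]
          exact Finset.sum_congr rfl fun col _ => by ring
      _ ≤ (∑ δ : Fin n × Bool → Fin n,
            (freshCount t x y δ ^ 2 - 2 * m * (1 - 2 * t * q) * freshCount t x y δ + m ^ 2)
              / m ^ 2) / (n : ℝ) ^ (2 * n) := by
          gcongr with δ
          exact sum_color_mem_Lb_le q hq0 hq1 t ht m hmpos x y δ
      _ = _ := by
          nth_rw 3 [← hconst]
          simp only [condAvg, Finset.piecewise_empty, hcard]
          rw [← Finset.sum_div, Finset.sum_add_distrib, Finset.sum_sub_distrib,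
            ← Finset.mul_sum]
          ring
  refine step.trans ?_
  have h1 := condAvg_freshCount_sq_le δ₀ t ht0 (by nlinarith) x y
  have h2 := le_condAvg_freshCount δ₀ t ht0 htn x y hxy
  rw [← hm] at h1 h2
  have h3 : m * (1 - 2 * t * q) * (m * (1 - t * (4 * t + 1) / n))
      ≤ m * (1 - 2 * t * q) * condAvg ∅ δ₀ (freshCount t x y) :=
    mul_le_mul_of_nonneg_left h2 (mul_nonneg hmpos.le (by linarith))
  have hinv : (n : ℝ) / 2 ^ t * m = 1 := by rw [hm]; field_simp
  rw [div_le_iff₀ (by positivity), failBound]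
  have ha : 0 ≤ 2 * (t : ℝ) * q * (t * (4 * t + 1) / n) := by positivity
  have hb := mul_nonneg (sq_nonneg m) ha
  have hi2 : (n : ℝ) / 2 ^ t * m ^ 2 = m := by rw [pow_two, ← mul_assoc, hinv, one_mul]
  generalize (n : ℝ) / 2 ^ t = z at *
  generalize (t * (4 * t + 1) / n : ℝ) = e at *
  nlinarith

lemma prob_card_Lb_le [NeZero n] (q : ℝ) (hq0 : 0 ≤ q) (hq1 : q ≤ 1) (t : ℕ) (ht0 : 0 < t)
    (ht : (t : ℝ) ≤ 2 * Real.logb 2 n) (htn : t * (4 * t + 1) ≤ n) (htq : 2 * t * q ≤ 1) :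
    ∑ δ : Fin n × Bool → Fin n, ∑ col : Fin n × Bool → Bool,
        ((1 / (n : ℝ) ^ (2 * n)) * ∏ k, if col k then q else 1 - q) *
        (if (n : ℝ) ^ 2 / 2 ≤ ((Lb n δ col).card : ℝ) then (1 : ℝ) else 0)
      ≤ 2 * failBound n t q := by
  have hnpos : (0 : ℝ) < n := by exact_mod_cast NeZero.pos n
  set P : (Fin n × Bool → Bool) → ℝ :=
    fun col => (1 / (n : ℝ) ^ (2 * n)) * ∏ k, if col k then q else 1 - q with hP
  have hP0 : ∀ col, 0 ≤ P col := fun col => mul_nonneg (by positivity)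
    (Finset.prod_nonneg fun k _ => by split_ifs <;> linarith)
  calc _ ≤ ∑ δ : Fin n × Bool → Fin n, ∑ col : Fin n × Bool → Bool,
          P col * (2 / (n : ℝ) ^ 2 *
            ∑ p : Fin n × Fin n, if p ∈ Lb n δ col then (1 : ℝ) else 0) := by
        refine Finset.sum_le_sum fun δ _ => Finset.sum_le_sum fun col _ =>
          mul_le_mul_of_nonneg_left ?_ (hP0 col)
        have hsum : (∑ p : Fin n × Fin n, if p ∈ Lb n δ col then (1 : ℝ) else 0)
            = (Lb n δ col).card := by simp
        rw [hsum]
        split_ifs with h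
        · rw [div_mul_eq_mul_div, le_div_iff₀ (by positivity)]
          linarith
        · positivity
    _ = 2 / (n : ℝ) ^ 2 * ∑ p : Fin n × Fin n, ∑ δ : Fin n × Bool → Fin n,
          ∑ col : Fin n × Bool → Bool, P col * (if p ∈ Lb n δ col then (1 : ℝ) else 0) := by
        simp only [Finset.mul_sum]
        rw [Finset.sum_comm (s := (Finset.univ : Finset (Fin n × Fin n)))]
        refine Finset.sum_congr rfl fun δ _ => ?_
        rw [Finset.sum_comm (s := (Finset.univ : Finset (Fin n × Fin n)))]
        exact Finset.sum_congr rfl fun col _ => Finset.sum_congr rfl fun p _ => by ring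
    _ ≤ 2 / (n : ℝ) ^ 2 * ∑ _p : Fin n × Fin n, failBound n t q := by
        gcongr with p
        exact prob_mem_Lb_le q hq0 hq1 t ht0 ht htn htq p.1 p.2
    _ = _ := by
        simp
        field_simp

end SecondMoment

section Asymptotics

open Filter Topology

lemma tendsto_logb_two_natCast : Tendsto (fun n : ℕ => Real.logb 2 n) atTop atTop :=
  (Real.tendsto_logb_atTop one_lt_two).comp tendsto_natCast_atTop_atTop

lemma tendsto_logb_two_pow_div (k : ℕ) :
    Tendsto (fun n : ℕ => Real.logb 2 n ^ k / (n : ℝ)) atTop (𝓝 0) := by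
  have h1 := (Real.isLittleO_pow_log_id_atTop (n := k)).tendsto_div_nhds_zero
  have h2 := (h1.comp tendsto_natCast_atTop_atTop).div_const (Real.log 2 ^ k)
  rw [zero_div] at h2
  refine h2.congr fun n => ?_
  simp only [Function.comp_apply, Real.logb, id, div_pow]
  ring

/-- An explicit bound for `failBound` in terms of `l = log₂ n`. -/
noncomputable def logFailBound (n : ℕ) : ℝ :=
  2 * (Real.logb 2 n ^ 0 / n) + 64 * (Real.logb 2 n ^ 4 / n) + 8 * (Real.logb 2 n)⁻¹
    + 32 * (Real.logb 2 n ^ 2 / n) + 4 * (Real.logb 2 n ^ 1 / n)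

lemma tendsto_logFailBound : Tendsto logFailBound atTop (𝓝 0) := by
  have h := ((((tendsto_logb_two_pow_div 0).const_mul 2).add
    ((tendsto_logb_two_pow_div 4).const_mul 64)).add
    (tendsto_logb_two_natCast.inv_tendsto_atTop.const_mul 8)).add
    ((tendsto_logb_two_pow_div 2).const_mul 32) |>.add
    ((tendsto_logb_two_pow_div 1).const_mul 4)
  simp only [mul_zero, add_zero] at h
  exact h

lemma natLog_sq_le (n : ℕ) : (Nat.log 2 (n ^ 2) : ℝ) ≤ 2 * Real.logb 2 n := by
  have h := Real.natLog_le_logb (n ^ 2) 2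
  push_cast at h
  rwa [Real.logb_pow] at h

lemma failBound_le_logFailBound (n : ℕ) (hn : 2 ≤ n) :
    failBound n (Nat.log 2 (n ^ 2)) (1 / Real.logb 2 n ^ 2) ≤ logFailBound n := by
  have hnpos : (0 : ℝ) < n := by exact_mod_cast (by omega : 0 < n)
  have hl : 0 < Real.logb 2 n := Real.logb_pos one_lt_two (by exact_mod_cast hn)
  have ht := natLog_sq_le n
  have hpow : (n : ℝ) ^ 2 ≤ 2 * 2 ^ Nat.log 2 (n ^ 2) := by
    have := Nat.lt_pow_succ_log_self one_lt_two (n ^ 2)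
    rw [Nat.succ_eq_add_one, pow_succ 2] at this
    exact_mod_cast (by linarith : n ^ 2 ≤ 2 * 2 ^ Nat.log 2 (n ^ 2))
  unfold failBound logFailBound
  generalize Nat.log 2 (n ^ 2) = t at *
  generalize Real.logb 2 n = l at *
  have ht0 : (0 : ℝ) ≤ t := Nat.cast_nonneg t
  have h1 : (n : ℝ) / 2 ^ t ≤ 2 * (l ^ 0 / n) := by
    rw [pow_zero, mul_one_div, div_le_div_iff₀ (by positivity) hnpos]
    linarith
  have h2 : 4 * (t : ℝ) ^ 4 / n ≤ 64 * (l ^ 4 / n) := by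
    calc 4 * (t : ℝ) ^ 4 / n ≤ 4 * (2 * l) ^ 4 / n := by gcongr
      _ = _ := by ring
  have h3 : 4 * (t : ℝ) * (1 / l ^ 2) ≤ 8 * l⁻¹ := by
    calc 4 * (t : ℝ) * (1 / l ^ 2) ≤ 4 * (2 * l) * (1 / l ^ 2) := by gcongr
      _ = _ := by field_simp; norm_num
  have h4 : 2 * ((t : ℝ) * (4 * t + 1) / n) ≤ 32 * (l ^ 2 / n) + 4 * (l ^ 1 / n) := by
    calc 2 * ((t : ℝ) * (4 * t + 1) / n) ≤ 2 * ((2 * l) * (4 * (2 * l) + 1) / n) := by gcongr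
      _ = _ := by ring
  linarith

end Asymptotics

/-- For a uniformly random automaton together with an independent
red/blue coloring of the transition pairs (each pair red with probability
`p = 1/(log₂ n)²`), the probability that `|L_b| ≥ n²/2` tends to `0`. -/
theorem Lb_small_whp :
    Filter.Tendsto
      (fun n : ℕ =>
        ∑ δ : Fin n × Bool → Fin n, ∑ col : Fin n × Bool → Bool,
          ((1 / (n : ℝ) ^ (2 * n)) *
            ∏ pr : Fin n × Bool,
              (if col pr then 1 / (Real.logb 2 n) ^ 2
                else 1 - 1 / (Real.logb 2 n) ^ 2)) *
          (if (n : ℝ) ^ 2 / 2 ≤ ((Lb n δ col).card : ℝ) then (1 : ℝ) else 0))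
      Filter.atTop (nhds 0) := by
  have hsmall : ∀ᶠ n : ℕ in Filter.atTop, logFailBound n < 1 :=
    tendsto_logFailBound.eventually_lt_const one_pos
  have hlim := tendsto_logFailBound.const_mul 2
  rw [mul_zero] at hlim
  refine squeeze_zero' ?_ ?_ hlim
  · filter_upwards [Filter.eventually_ge_atTop 2] with n hn
    have hl : 1 ≤ Real.logb 2 n := by
      rw [Real.le_logb_iff_rpow_le one_lt_two (by positivity), Real.rpow_one]
      exact_mod_cast hn
    have hq1 : 1 / Real.logb 2 n ^ 2 ≤ 1 := div_le_one_of_le₀ (one_le_pow₀ hl) (by positivity)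
    have hq0 : 0 ≤ 1 / Real.logb 2 n ^ 2 := by positivity
    refine Finset.sum_nonneg fun δ _ => Finset.sum_nonneg fun col _ => ?_
    refine mul_nonneg (mul_nonneg (by positivity) (Finset.prod_nonneg fun k _ => ?_)) ?_ <;>
      split_ifs <;> linarith
  · filter_upwards [Filter.eventually_ge_atTop 2, hsmall] with n hn hn1
    have : NeZero n := ⟨by omega⟩
    have hnpos : (0 : ℝ) < n := by exact_mod_cast NeZero.pos n
    have hl : 1 ≤ Real.logb 2 n := by
      rw [Real.le_logb_iff_rpow_le one_lt_two (by positivity), Real.rpow_one]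
      exact_mod_cast hn
    have hq1 : 1 / Real.logb 2 n ^ 2 ≤ 1 := div_le_one_of_le₀ (one_le_pow₀ hl) (by positivity)
    have hq0 : 0 ≤ 1 / Real.logb 2 n ^ 2 := by positivity
    have hbound := failBound_le_logFailBound n hn
    have ht0 : 0 < Nat.log 2 (n ^ 2) := Nat.log_pos one_lt_two (by nlinarith)
    have htl := natLog_sq_le n
    have hlt : failBound n (Nat.log 2 (n ^ 2)) (1 / Real.logb 2 n ^ 2) < 1 :=
      hbound.trans_lt hn1
    refine (prob_card_Lb_le (1 / Real.logb 2 n ^ 2) hq0 hq1 (Nat.log 2 (n ^ 2)) ht0 htl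
      ?_ ?_).trans (by linarith)
    · have h1 : (Nat.log 2 (n ^ 2) : ℝ) * (4 * Nat.log 2 (n ^ 2) + 1) / n ≤ 1 := by
        unfold failBound at hlt
        have e1 : (0 : ℝ) ≤ n / 2 ^ Nat.log 2 (n ^ 2) := by positivity
        have e2 : (0 : ℝ) ≤ 4 * (Nat.log 2 (n ^ 2) : ℝ) ^ 4 / n := by positivity
        have e3 : (0 : ℝ) ≤ 4 * (Nat.log 2 (n ^ 2) : ℝ) * (1 / Real.logb 2 n ^ 2) := by
          positivity
        have e4 : (0 : ℝ) ≤ (Nat.log 2 (n ^ 2) : ℝ) * (4 * Nat.log 2 (n ^ 2) + 1) / n := by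
          positivity
        linarith
      rw [div_le_one hnpos] at h1
      exact_mod_cast h1
    · unfold failBound at hlt
      have e1 : (0 : ℝ) ≤ n / 2 ^ Nat.log 2 (n ^ 2) := by positivity
      have e2 : (0 : ℝ) ≤ 4 * (Nat.log 2 (n ^ 2) : ℝ) ^ 4 / n := by positivity
      have e3 : (0 : ℝ) ≤ 4 * (Nat.log 2 (n ^ 2) : ℝ) * (1 / Real.logb 2 n ^ 2) := by
        positivity
      have e4 : (0 : ℝ) ≤ (Nat.log 2 (n ^ 2) : ℝ) * (4 * Nat.log 2 (n ^ 2) + 1) / n := by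
        positivity
      linarith
end

section
/- There is a constant C > 0 such that for all n ≥ 2 and every fixed pair of states x, y ∈ Fin n the following holds. Let δ : Fin n × {a,b} → Fin n be a uniformly random transition function, and independently color each pair (x,c) ∈ Fin n × {a,b} red with probability p := 1/(log₂ n)² and blue otherwise, independently over pairs; define d(x,y), d_b(x,y) and L_b := {(x,y) : d_b(x,y) > 2·log₂ n} as below. Then with probability at least 1 − C/n², at least one of the following occurs: (i) d(x,y) ≤ 2.5·log₂ n, or (ii) |L_b| ≥ n²/2. -/
open scoped BigOperators Classical

/-- Expectation of `f` when the coordinates are independent with weights `μ`. -/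
noncomputable def prodExp {ι α : Type*} [Fintype ι] [DecidableEq ι] [Fintype α]
    (μ : α → ℝ) (f : (ι → α) → ℝ) : ℝ :=
  ∑ ω, (∏ i, μ (ω i)) * f ω

section ProdExp

variable {ι α : Type*} [Fintype ι] [DecidableEq ι] [Fintype α] {μ : α → ℝ}

theorem prodExp_mono (hμ : ∀ a, 0 ≤ μ a) {f g : (ι → α) → ℝ} (h : ∀ ω, f ω ≤ g ω) :
    prodExp μ f ≤ prodExp μ g :=
  Finset.sum_le_sum fun ω _ =>
    mul_le_mul_of_nonneg_left (h ω) (Finset.prod_nonneg fun _ _ => hμ _)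

theorem prodExp_nonneg (hμ : ∀ a, 0 ≤ μ a) {f : (ι → α) → ℝ} (h : ∀ ω, 0 ≤ f ω) :
    0 ≤ prodExp μ f :=
  Finset.sum_nonneg fun ω _ => mul_nonneg (Finset.prod_nonneg fun _ _ => hμ _) (h ω)

theorem prodExp_add (f g : (ι → α) → ℝ) :
    prodExp μ (fun ω => f ω + g ω) = prodExp μ f + prodExp μ g := by
  simp only [prodExp, mul_add, Finset.sum_add_distrib]

theorem prodExp_const_mul (c : ℝ) (f : (ι → α) → ℝ) :
    prodExp μ (fun ω => c * f ω) = c * prodExp μ f := by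
  simp only [prodExp, Finset.mul_sum]
  exact Finset.sum_congr rfl fun _ _ => by ring

theorem prodExp_sum {κ : Type*} (s : Finset κ) (f : κ → (ι → α) → ℝ) :
    prodExp μ (fun ω => ∑ k ∈ s, f k ω) = ∑ k ∈ s, prodExp μ (f k) := by
  simp only [prodExp, Finset.mul_sum]
  exact Finset.sum_comm

theorem prodExp_const (hμ : ∑ a, μ a = 1) (c : ℝ) :
    prodExp μ (fun _ : ι → α => c) = c := by
  have h := Finset.prod_univ_sum (fun _ : ι => (Finset.univ : Finset α)) (fun _ a => μ a)
  simp only [hμ, Finset.prod_const_one, Fintype.piFinset_univ] at h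
  rw [prodExp, ← Finset.sum_mul, ← h, one_mul]

theorem prodExp_comm {ι' α' : Type*} [Fintype ι'] [DecidableEq ι'] [Fintype α'] {μ' : α' → ℝ}
    (f : (ι → α) → (ι' → α') → ℝ) :
    prodExp μ (fun ω => prodExp μ' (f ω)) = prodExp μ' fun ω' => prodExp μ fun ω => f ω ω' := by
  simp only [prodExp, Finset.mul_sum]
  rw [Finset.sum_comm]
  exact Finset.sum_congr rfl fun _ _ => Finset.sum_congr rfl fun _ _ => by ring

/-- Resampling one coordinate does not change the expectation. -/
theorem prodExp_resample (hμ : ∑ a, μ a = 1) (p : ι) (f : (ι → α) → ℝ) :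
    prodExp μ f = prodExp μ fun ω => ∑ b, μ b * f (Function.update ω p b) := by
  have hw : ∀ (ω : ι → α) (b : α),
      (∏ i, μ (Function.update ω p b i)) * μ (ω p) = (∏ i, μ (ω i)) * μ b := by
    intro ω b
    rw [← Finset.mul_prod_erase _ _ (Finset.mem_univ p),
      ← Finset.mul_prod_erase Finset.univ (fun i => μ (ω i)) (Finset.mem_univ p),
      Finset.prod_congr rfl fun i hi => by
        rw [Function.update_of_ne (Finset.ne_of_mem_erase hi)]]
    rw [Function.update_self]
    ring
  let σ : ((ι → α) × α) → ((ι → α) × α) := fun z => (Function.update z.1 p z.2, z.1 p)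
  have hσ : Function.Involutive σ := by
    rintro ⟨ω, b⟩
    simp [σ]
  have key : ∑ z : (ι → α) × α, (∏ i, μ (z.1 i)) * μ z.2 * f z.1 =
      ∑ z : (ι → α) × α, (∏ i, μ (z.1 i)) * μ z.2 * f (Function.update z.1 p z.2) := by
    refine Fintype.sum_equiv hσ.toPerm _ _ ?_
    rintro ⟨ω, b⟩
    simp [σ, hw]
  rw [Fintype.sum_prod_type, Fintype.sum_prod_type] at key
  simp only [prodExp]
  calc _ = ∑ ω : ι → α, ∑ b, (∏ i, μ (ω i)) * μ b * f ω := by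
        refine Finset.sum_congr rfl fun ω _ => ?_
        rw [← Finset.sum_mul, ← Finset.mul_sum, hμ, mul_one]
    _ = _ := key
    _ = _ := by
        simp only [Finset.mul_sum, mul_assoc]

/-- Two coordinates that `h` ignores can be integrated out. -/
theorem prodExp_mul_of_invariant (hμ : ∑ a, μ a = 1) {p q : ι} (hpq : p ≠ q)
    {h : (ι → α) → ℝ} (hp : ∀ ω b, h (Function.update ω p b) = h ω)
    (hq : ∀ ω b, h (Function.update ω q b) = h ω) (g : α → α → ℝ) :
    prodExp μ (fun ω => h ω * g (ω p) (ω q)) =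
      (∑ a, ∑ b, μ a * μ b * g a b) * prodExp μ h := by
  rw [prodExp_resample hμ p]
  simp only [hp, Function.update_self, Function.update_of_ne hpq.symm]
  rw [prodExp_resample hμ q]
  simp only [hq, Function.update_self]
  rw [← prodExp_const_mul]
  congr 1
  funext ω
  simp only [Finset.mul_sum, Finset.sum_mul]
  rw [Finset.sum_comm]
  exact Finset.sum_congr rfl fun _ _ => Finset.sum_congr rfl fun _ _ => by ring

theorem prodExp_mul_indicator [DecidableEq α] (hμ : ∑ a, μ a = 1) {p q : ι} (hpq : p ≠ q)
    {h : (ι → α) → ℝ} (hp : ∀ ω b, h (Function.update ω p b) = h ω)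
    (hq : ∀ ω b, h (Function.update ω q b) = h ω) (u v : α) :
    prodExp μ (fun ω => h ω * if ω p = u ∧ ω q = v then 1 else 0) =
      μ u * μ v * prodExp μ h := by
  rw [prodExp_mul_of_invariant hμ hpq hp hq fun a b => if a = u ∧ b = v then 1 else 0]
  congr 1
  simp [ite_and]

/-- Splitting an expectation according to the values at two coordinates. -/
theorem prodExp_split [DecidableEq α] (p q : ι) (F : α → α → (ι → α) → ℝ) :
    prodExp μ (fun ω => F (ω p) (ω q) ω) =
      ∑ u, ∑ v, prodExp μ fun ω => (if ω p = u ∧ ω q = v then 1 else 0) * F u v ω := by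
  simp only [← prodExp_sum]
  congr 1
  funext ω
  simp [ite_and]

end ProdExp

/-- Two states on which a common letter is to be read, together with the number of further
letters that may be read afterwards. -/
structure PairQuery (n : ℕ) where
  left : Fin n
  right : Fin n
  letter : Bool
  budget : ℕ

namespace PairQuery

variable {n : ℕ}

def leftCoord (e : PairQuery n) : Fin n × Bool := (e.left, e.letter)

def rightCoord (e : PairQuery n) : Fin n × Bool := (e.right, e.letter)

/-- All transition pairs occurring in a list of queries. -/
def coords (s : List (PairQuery n)) : List (Fin n × Bool) :=
  s.flatMap fun e => [e.leftCoord, e.rightCoord]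

@[simp] theorem coords_nil : coords ([] : List (PairQuery n)) = [] := rfl

@[simp] theorem coords_cons (e : PairQuery n) (s : List (PairQuery n)) :
    coords (e :: s) = e.leftCoord :: e.rightCoord :: coords s := rfl

@[simp] theorem coords_append (s t : List (PairQuery n)) :
    coords (s ++ t) = coords s ++ coords t := by
  simp [coords]

/-- The two queries at a newly discovered pair of states. -/
def children (u v : Fin n) : ℕ → List (PairQuery n)
  | 0 => []
  | k + 1 => [⟨u, v, false, k⟩, ⟨u, v, true, k⟩]

/-- The outcome `(u, v)` of a query consists of two distinct unvisited states. -/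
def IsNew (V : Finset (Fin n)) (u v : Fin n) : Prop := u ∉ V ∧ v ∉ V ∧ u ≠ v

noncomputable def nextQueue (k : ℕ) (s : List (PairQuery n)) (V : Finset (Fin n))
    (u v : Fin n) : List (PairQuery n) :=
  if IsNew V u v then s ++ children u v k else s

noncomputable def nextVisited (V : Finset (Fin n)) (u v : Fin n) : Finset (Fin n) :=
  if IsNew V u v then insert u (insert v V) else V

/-- The queries made during `r` steps of the breadth-first exploration of pairs of states,
starting from the queue `s` and the set `V` of visited states. -/
noncomputable def explore (δ : Fin n × Bool → Fin n) :
    ℕ → List (PairQuery n) → Finset (Fin n) → List (PairQuery n)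
  | 0, _, _ => []
  | _ + 1, [], _ => []
  | r + 1, e :: s, V =>
    e :: explore δ r (nextQueue e.budget s V (δ e.leftCoord) (δ e.rightCoord))
      (nextVisited V (δ e.leftCoord) (δ e.rightCoord))

/-- The queued transition pairs are distinct and start at visited states. -/
def Valid (s : List (PairQuery n)) (V : Finset (Fin n)) : Prop :=
  (coords s).Nodup ∧ ∀ i ∈ coords s, i.1 ∈ V

/-- Transition pairs that have not been revealed yet. -/
def Fresh (s : List (PairQuery n)) (V : Finset (Fin n)) (i : Fin n × Bool) : Prop :=
  i ∈ coords s ∨ i.1 ∉ V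

theorem mem_coords_children {u v : Fin n} {k : ℕ} {i : Fin n × Bool}
    (h : i ∈ coords (children u v k)) : i.1 = u ∨ i.1 = v := by
  cases k with
  | zero => simp [children] at h
  | succ k =>
    simp only [children, coords_cons, coords_nil, leftCoord, rightCoord, List.mem_cons,
      List.not_mem_nil, or_false] at h
    rcases h with h | h | h | h <;> simp [h]

theorem nodup_coords_children {u v : Fin n} (huv : u ≠ v) (k : ℕ) :
    (coords (children u v k)).Nodup := by
  cases k with
  | zero => simp [children]
  | succ k => simp [children, leftCoord, rightCoord, huv]

theorem Valid.next {e : PairQuery n} {s : List (PairQuery n)} {V : Finset (Fin n)}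
    (h : Valid (e :: s) V) (u v : Fin n) :
    Valid (nextQueue e.budget s V u v) (nextVisited V u v) := by
  obtain ⟨hnd, hV⟩ := h
  simp only [coords_cons, List.nodup_cons, List.mem_cons] at hnd hV
  unfold nextQueue nextVisited
  split_ifs with hn
  · obtain ⟨hu, hv, huv⟩ := hn
    refine ⟨?_, fun i hi => ?_⟩
    · rw [coords_append, List.nodup_append']
      refine ⟨hnd.2.2, nodup_coords_children huv _, fun i hi hi' => ?_⟩
      have h1 := hV i (.inr (.inr hi))
      rcases mem_coords_children hi' with h2 | h2 <;> rw [h2] at h1 <;> contradiction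
    · rw [coords_append, List.mem_append] at hi
      rcases hi with hi | hi
      · simp [hV i (.inr (.inr hi))]
      · rcases mem_coords_children hi with h2 | h2 <;> simp [h2]
  · exact ⟨hnd.2.2, fun i hi => hV i (.inr (.inr hi))⟩

theorem Fresh.of_next {e : PairQuery n} {s : List (PairQuery n)} {V : Finset (Fin n)}
    (h : Valid (e :: s) V) {u v : Fin n} {i : Fin n × Bool}
    (hi : Fresh (nextQueue e.budget s V u v) (nextVisited V u v) i) :
    Fresh (e :: s) V i ∧ i ≠ e.leftCoord ∧ i ≠ e.rightCoord := by
  obtain ⟨hnd, hV⟩ := h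
  simp only [coords_cons, List.nodup_cons, List.mem_cons, not_or] at hnd hV
  have hl : e.leftCoord.1 ∈ V := hV _ (.inl rfl)
  have hr : e.rightCoord.1 ∈ V := hV _ (.inr (.inl rfl))
  have key : i ∈ coords s ∨ i.1 ∉ V := by
    unfold nextQueue nextVisited at hi
    split_ifs at hi with hn
    · obtain ⟨hu, hv, -⟩ := hn
      rcases hi with hi | hi
      · rw [coords_append, List.mem_append] at hi
        rcases hi with hi | hi
        · exact .inl hi
        · rcases mem_coords_children hi with h2 | h2 <;> exact .inr (by rwa [h2])
      · exact .inr fun h => hi (by simp [h])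
    · exact hi
  rcases key with hi | hi
  · refine ⟨.inl (by simp [hi]), ?_, ?_⟩ <;> rintro rfl
    · exact hnd.1.2 hi
    · exact hnd.2.1 hi
  · refine ⟨.inr hi, ?_, ?_⟩ <;> rintro rfl <;> contradiction

theorem Valid.tail {e : PairQuery n} {s : List (PairQuery n)} {V : Finset (Fin n)}
    (h : Valid (e :: s) V) : Valid s V := by
  obtain ⟨h1, h2⟩ := h
  simp only [coords_cons, List.nodup_cons, List.mem_cons] at h1 h2
  exact ⟨h1.2.2, fun i hi => h2 i (.inr (.inr hi))⟩

theorem Valid.left_ne_right {e : PairQuery n} {s : List (PairQuery n)} {V : Finset (Fin n)}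
    (h : Valid (e :: s) V) : e.leftCoord ≠ e.rightCoord := by
  have := h.1
  simp only [coords_cons, List.nodup_cons, List.mem_cons, not_or] at this
  exact this.1.1

theorem fresh_leftCoord (e : PairQuery n) (s : List (PairQuery n)) (V : Finset (Fin n)) :
    Fresh (e :: s) V e.leftCoord := .inl (by simp)

theorem fresh_rightCoord (e : PairQuery n) (s : List (PairQuery n)) (V : Finset (Fin n)) :
    Fresh (e :: s) V e.rightCoord := .inl (by simp)

theorem explore_coords (δ : Fin n × Bool → Fin n) (r : ℕ) :
    ∀ (s : List (PairQuery n)) (V : Finset (Fin n)), Valid s V →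
      (coords (explore δ r s V)).Nodup ∧ ∀ i ∈ coords (explore δ r s V), Fresh s V i := by
  induction r with
  | zero => intro s V _; simp [explore]
  | succ r ih =>
    intro s V h
    cases s with
    | nil => simp [explore]
    | cons e s =>
      obtain ⟨h1, h2⟩ := ih _ _ (h.next (δ e.leftCoord) (δ e.rightCoord))
      have h3 := fun i hi => Fresh.of_next h (h2 i hi)
      simp only [explore, coords_cons, List.nodup_cons, List.mem_cons, not_or]
      refine ⟨⟨⟨h.left_ne_right, fun hm => (h3 _ hm).2.1 rfl⟩, fun hm => (h3 _ hm).2.2 rfl, h1⟩,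
        ?_⟩
      rintro i (rfl | rfl | hi)
      · exact fresh_leftCoord e s V
      · exact fresh_rightCoord e s V
      · exact (h3 i hi).1

end PairQuery

/-- The uniform weight on `Fin n`. -/
noncomputable def unif (n : ℕ) : Fin n → ℝ := fun _ => 1 / n

theorem sum_unif {n : ℕ} (hn : 0 < n) : ∑ a, unif n a = 1 := by
  have : (n : ℝ) ≠ 0 := by positivity
  simp [unif, this]

theorem unif_nonneg (n : ℕ) (a : Fin n) : 0 ≤ unif n a := by
  unfold unif
  positivity

/-- The weights of the two colors, red having probability `p`. -/
def colorWeight (p : ℝ) (b : Bool) : ℝ := if b then p else 1 - p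

theorem sum_colorWeight (p : ℝ) : ∑ b, colorWeight p b = 1 := by
  simp [colorWeight]

theorem run_append {n : ℕ} (δ : Fin n × Bool → Fin n) (v w : List Bool) (x : Fin n) :
    run δ (v ++ w) x = run δ w (run δ v x) := by
  induction v generalizing x with
  | nil => rfl
  | cons c v ih => exact ih _

namespace PairQuery

variable {n : ℕ}

/-- Every explored pair of states is reached from `(x, y)` by a word whose length leaves room for
the remaining budget. -/
theorem exists_word_of_mem_explore (δ : Fin n × Bool → Fin n) (x y : Fin n) (D r : ℕ) :
    ∀ (s : List (PairQuery n)) (V : Finset (Fin n)),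
      (∀ e ∈ s, ∃ w : List Bool, w.length + e.budget + 1 ≤ D ∧
        run δ w x = e.left ∧ run δ w y = e.right) →
      ∀ e ∈ explore δ r s V, ∃ w : List Bool, w.length + e.budget + 1 ≤ D ∧
        run δ w x = e.left ∧ run δ w y = e.right := by
  induction r with
  | zero => intro s V _ e he; simp [explore] at he
  | succ r ih =>
    intro s V h
    cases s with
    | nil => intro e he; simp [explore] at he
    | cons e s =>
      simp only [explore, List.mem_cons, forall_eq_or_imp]
      refine ⟨h e (by simp), ih _ _ fun f hf => ?_⟩
      unfold nextQueue at hf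
      split_ifs at hf
      · rw [List.mem_append] at hf
        rcases hf with hf | hf
        · exact h f (by simp [hf])
        · obtain ⟨w, hw, hx, hy⟩ := h e (by simp)
          rcases hk : e.budget with _ | k
          · simp [hk, children] at hf
          · simp only [hk, children, List.mem_cons, List.not_mem_nil, or_false] at hf hw
            refine ⟨w ++ [e.letter], ?_, ?_, ?_⟩
            · rcases hf with rfl | rfl <;> simp only [List.length_append, List.length_singleton] <;>
                omega
            · rcases hf with rfl | rfl <;> simp [run_append, run, hx, leftCoord]
            · rcases hf with rfl | rfl <;> simp [run_append, run, hy, rightCoord]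
      · exact h f (by simp [hf])

/-- Conditionally on everything revealed so far, the exploration stops before making `r` queries
with probability at most `B`. -/
def ExtinctionBound (r : ℕ) (s : List (PairQuery n)) (V : Finset (Fin n)) (B : ℝ) : Prop :=
  ∀ h : (Fin n × Bool → Fin n) → ℝ, (∀ δ, 0 ≤ h δ) →
    (∀ i, Fresh s V i → ∀ δ b, h (Function.update δ i b) = h δ) →
    prodExp (unif n) (fun δ => h δ * if (explore δ r s V).length < r then 1 else 0) ≤
      B * prodExp (unif n) h

theorem ExtinctionBound.mono {r : ℕ} {s : List (PairQuery n)} {V : Finset (Fin n)} {B B' : ℝ}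
    (hB : ExtinctionBound r s V B) (h : B ≤ B') : ExtinctionBound r s V B' :=
  fun f hf hi => (hB f hf hi).trans
    (mul_le_mul_of_nonneg_right h (prodExp_nonneg (unif_nonneg n) hf))

theorem extinctionBound_one (r : ℕ) (s : List (PairQuery n)) (V : Finset (Fin n)) :
    ExtinctionBound r s V 1 := by
  intro h hh _
  rw [one_mul]
  refine prodExp_mono (unif_nonneg n) fun δ => ?_
  split_ifs <;> simp [hh δ]

theorem sum_not_isNew_le (V : Finset (Fin n)) :
    ∑ u, ∑ v, (if IsNew V u v then (0 : ℝ) else 1) ≤ (2 * V.card + 1) * n := by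
  calc ∑ u, ∑ v, (if IsNew V u v then (0 : ℝ) else 1)
      ≤ ∑ u : Fin n, ∑ v : Fin n, ((if u ∈ V then (1 : ℝ) else 0) + (if v ∈ V then 1 else 0)
          + if u = v then 1 else 0) := by
        refine Finset.sum_le_sum fun u _ => Finset.sum_le_sum fun v _ => ?_
        by_cases h1 : u ∈ V <;> by_cases h2 : v ∈ V <;> by_cases h3 : u = v <;>
          simp [IsNew, h1, h2, h3]
    _ = (2 * V.card + 1) * n := by
        simp only [Finset.sum_add_distrib, Finset.sum_ite_mem, Finset.univ_inter,
          Finset.sum_const, Finset.card_univ, Fintype.card_fin, nsmul_eq_mul, mul_one,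
          Finset.sum_ite_eq, Finset.mem_univ, if_true, ← Finset.mul_sum]
        ring

theorem ExtinctionBound.step (hn : 0 < n) {r : ℕ} {e : PairQuery n} {s : List (PairQuery n)}
    {V : Finset (Fin n)} (hv : Valid (e :: s) V) {B₁ B₂ : ℝ} (h₁ : 0 ≤ B₁) (h₂ : 0 ≤ B₂)
    (hnew : ∀ u v, IsNew V u v →
      ExtinctionBound r (s ++ children u v e.budget) (insert u (insert v V)) B₁)
    (hold : ExtinctionBound r s V B₂) :
    ExtinctionBound (r + 1) (e :: s) V (B₁ + (2 * V.card + 1) / n * B₂) := by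
  intro h hh hinv
  have hn' : (0 : ℝ) < n := by positivity
  have hE := prodExp_nonneg (unif_nonneg n) hh
  have hl := hinv _ (fresh_leftCoord e s V)
  have hr := hinv _ (fresh_rightCoord e s V)
  have hbound : ∀ u v, prodExp (unif n) (fun δ =>
      (if δ e.leftCoord = u ∧ δ e.rightCoord = v then 1 else 0) *
        (h δ * if (explore δ r (nextQueue e.budget s V u v) (nextVisited V u v)).length < r
          then 1 else 0)) ≤
      (B₁ + (if IsNew V u v then 0 else 1) * B₂) * (1 / n * (1 / n) * prodExp (unif n) h) := by
    intro u v
    have key : ExtinctionBound r (nextQueue e.budget s V u v) (nextVisited V u v)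
        (B₁ + (if IsNew V u v then 0 else 1) * B₂) := by
      unfold nextQueue nextVisited
      split_ifs with hN
      · exact (hnew u v hN).mono (by simp)
      · exact hold.mono (by simpa using h₁)
    have := key (fun δ => h δ * if δ e.leftCoord = u ∧ δ e.rightCoord = v then 1 else 0)
      (fun δ => mul_nonneg (hh δ) (by split_ifs <;> norm_num)) (by
        intro i hi δ b
        obtain ⟨h1, h2, h3⟩ := Fresh.of_next hv hi
        simp only [hinv i h1, Function.update_of_ne h2.symm, Function.update_of_ne h3.symm])
    rw [prodExp_mul_indicator (sum_unif hn) hv.left_ne_right hl hr] at this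
    refine le_trans (le_of_eq ?_) this
    congr 1
    funext δ
    ring
  have hsplit : prodExp (unif n)
      (fun δ => h δ * if (explore δ (r + 1) (e :: s) V).length < r + 1 then 1 else 0) =
      ∑ u, ∑ v, prodExp (unif n) (fun δ =>
      (if δ e.leftCoord = u ∧ δ e.rightCoord = v then 1 else 0) *
        (h δ * if (explore δ r (nextQueue e.budget s V u v) (nextVisited V u v)).length < r
          then 1 else 0)) := by
    rw [← prodExp_split e.leftCoord e.rightCoord fun u v δ =>
      h δ * if (explore δ r (nextQueue e.budget s V u v) (nextVisited V u v)).length < r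
          then 1 else 0]
    simp only [explore, List.length_cons, Nat.add_lt_add_iff_right]
  rw [hsplit]
  refine (Finset.sum_le_sum fun u _ => Finset.sum_le_sum fun v _ => hbound u v).trans ?_
  simp only [← Finset.sum_mul, Finset.sum_add_distrib, Finset.sum_const, Finset.card_univ,
    Fintype.card_fin, nsmul_eq_mul]
  rw [← mul_assoc (_ + _)]
  refine mul_le_mul_of_nonneg_right ?_ hE
  have h3 := mul_le_mul_of_nonneg_right (sum_not_isNew_le V) h₂
  calc _ ≤ (↑n * ↑n * B₁ + (2 * V.card + 1) * n * B₂) * (1 / n * (1 / n)) := by gcongr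
    _ = _ := by field_simp

/-- The number of queries in a complete subtree whose root has the given budget. -/
def subtreeSize (k : ℕ) : ℕ := 2 ^ (k + 1) - 1

theorem subtreeSize_succ (k : ℕ) : subtreeSize (k + 1) = 2 * subtreeSize k + 1 := by
  have : 1 ≤ 2 ^ (k + 1) := Nat.one_le_two_pow
  simp only [subtreeSize, pow_succ 2 (k + 1)]
  omega

/-- The number of further queries that can be made if no query fails. -/
def capacity (s : List (PairQuery n)) : ℕ := (s.map fun e => subtreeSize e.budget).sum

theorem capacity_children (u v : Fin n) (k : ℕ) :
    capacity (children u v k) + 1 = subtreeSize k := by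
  cases k with
  | zero => simp [capacity, children, subtreeSize]
  | succ k =>
    rw [subtreeSize_succ]
    simp only [capacity, children, List.map_cons, List.map_nil, List.sum_cons, List.sum_nil]
    omega

theorem subtreeSize_le_of_mem_children {u v : Fin n} {k : ℕ} {e : PairQuery n}
    (he : e ∈ children u v k) : subtreeSize e.budget ≤ subtreeSize k := by
  cases k with
  | zero => simp [children] at he
  | succ k =>
    simp only [children, List.mem_cons, List.not_mem_nil, or_false] at he
    rw [subtreeSize_succ]
    rcases he with rfl | rfl <;> simp only <;> omega

/-- If the exploration can afford fewer than `K` failed queries, it stops early with probability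
at most `(r q) ^ K`, where `q` bounds the probability of a single failure. -/
theorem extinctionBound_of_capacity (hn : 0 < n) {q : ℝ} (S r : ℕ) :
    ∀ (K : ℕ) (s : List (PairQuery n)) (V : Finset (Fin n)), Valid s V →
      (∀ e ∈ s, subtreeSize e.budget ≤ S) → r + K * S ≤ capacity s + S →
      (2 * V.card + 4 * r + 1) / n ≤ q → ExtinctionBound r s V ((r * q) ^ K) := by
  have hn' : (0 : ℝ) < n := by positivity
  induction r with
  | zero =>
    intro K s V _ _ _ hq h hh _
    have hq0 : 0 ≤ q := le_trans (by positivity) hq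
    simp only [not_lt_zero, if_false, mul_zero]
    rw [prodExp]
    simp only [mul_zero, Finset.sum_const_zero]
    exact mul_nonneg (by positivity) (prodExp_nonneg (unif_nonneg n) hh)
  | succ r ih =>
    intro K s V hv hS hcap hq
    have hq0 : 0 ≤ q := le_trans (by positivity) hq
    push_cast at hq
    rcases K with _ | K
    · simpa using extinctionBound_one (r + 1) s V
    cases s with
    | nil =>
      exfalso
      simp only [capacity, List.map_nil, List.sum_nil] at hcap
      rw [add_mul] at hcap
      omega
    | cons e s =>
      have hes := hS e (by simp)
      have hce : capacity (e :: s) = subtreeSize e.budget + capacity s := by simp [capacity]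
      rw [hce, add_mul] at hcap
      have hvs : Valid s V := hv.tail
      have hstep := ExtinctionBound.step hn hv (r := r) (B₁ := (r * q) ^ (K + 1))
        (B₂ := (r * q) ^ K) (by positivity) (by positivity)
        (by
          intro u v hN
          have hvn := hv.next u v
          simp only [nextQueue, nextVisited, if_pos hN] at hvn
          refine ih (K + 1) _ _ hvn ?_ ?_ ?_
          · intro f hf
            rw [List.mem_append] at hf
            rcases hf with hf | hf
            · exact hS f (by simp [hf])
            · exact (subtreeSize_le_of_mem_children hf).trans hes
          · have := capacity_children u v e.budget
            have h2 : capacity (s ++ children u v e.budget) =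
                capacity s + capacity (children u v e.budget) := by simp [capacity]
            rw [h2, add_mul]
            omega
          · refine le_trans ?_ hq
            have hc : (insert u (insert v V)).card ≤ V.card + 2 :=
              (Finset.card_insert_le _ _).trans
                (Nat.succ_le_succ (Finset.card_insert_le _ _))
            have hc' : ((insert u (insert v V)).card : ℝ) ≤ V.card + 2 := by exact_mod_cast hc
            gcongr ?_ / _
            linarith)
        (by
          refine ih K s V hvs (fun f hf => hS f (by simp [hf])) (by omega) (le_trans ?_ hq)
          gcongr ?_ / _
          linarith)
      refine hstep.mono ?_
      have hfail : (2 * V.card + 1 : ℝ) / n ≤ q := by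
        refine le_trans ?_ hq
        gcongr ?_ / _
        have : (0 : ℝ) ≤ r := by positivity
        linarith
      calc _ ≤ (r * q) ^ (K + 1) + q * (r * q) ^ K := by gcongr
        _ = (r * q) ^ K * (((r + 1 : ℕ) : ℝ) * q) := by push_cast; ring
        _ ≤ (((r + 1 : ℕ) : ℝ) * q) ^ K * (((r + 1 : ℕ) : ℝ) * q) := by
          gcongr
          exact Nat.le_succ r
        _ = _ := (pow_succ _ _).symm

theorem valid_children {x y : Fin n} (hxy : x ≠ y) (k : ℕ) : Valid (children x y k) {x, y} :=
  ⟨nodup_coords_children hxy k, fun i hi => by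
    rcases mem_coords_children hi with h | h <;> simp [h]⟩

/-- The exploration from a pair of distinct states stops early with probability `O(n⁻²)`. -/
theorem extinctionBound_children (hn : 0 < n) {x y : Fin n} (hxy : x ≠ y) {t k : ℕ}
    (ht : t ≤ subtreeSize k) {q : ℝ} (hq : (4 * t + 13 : ℝ) / n ≤ q) :
    ExtinctionBound (t + 2) (children x y (k + 2)) {x, y}
      (((t * q) ^ 3 + 9 / n * (t * q) ^ 2) + 5 / n * ((t * q) ^ 2 + 5 / n)) := by
  have hn' : (0 : ℝ) < n := by positivity
  have hq0 : 0 ≤ q := le_trans (by positivity) hq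
  have hcap : ∀ u v : Fin n, capacity (children u v (k + 1)) = 2 * subtreeSize k := by
    intro u v
    have := capacity_children u v (k + 1)
    rw [subtreeSize_succ] at this
    omega
  have hsize : ∀ (u v : Fin n), ∀ e ∈ children u v (k + 1),
      subtreeSize e.budget ≤ subtreeSize k := by
    intro u v e he
    simp only [children, List.mem_cons, List.not_mem_nil, or_false] at he
    rcases he with rfl | rfl <;> exact le_rfl
  have hq' : ∀ V : Finset (Fin n), V.card ≤ 6 → (2 * V.card + 4 * t + 1 : ℝ) / n ≤ q := by
    intro V hV
    refine le_trans ?_ hq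
    have : (V.card : ℝ) ≤ 6 := by exact_mod_cast hV
    gcongr ?_ / _
    linarith
  have hins : ∀ (u v : Fin n) (V : Finset (Fin n)),
      (insert u (insert v V)).card ≤ V.card + 2 := fun u v V =>
    (Finset.card_insert_le _ _).trans (Nat.succ_le_succ (Finset.card_insert_le _ _))
  have hc2 : ({x, y} : Finset (Fin n)).card = 2 := Finset.card_pair hxy
  have hv0 : Valid [⟨x, y, false, k + 1⟩, ⟨x, y, true, k + 1⟩] {x, y} :=
    valid_children hxy (k + 2)
  refine ExtinctionBound.mono (ExtinctionBound.step hn hv0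
    (B₁ := (t * q) ^ 3 + 9 / n * (t * q) ^ 2) (B₂ := (t * q) ^ 2 + 5 / n)
    (by positivity) (by positivity) ?_ ?_) ?_
  · intro u v hN
    have hv1 := hv0.next u v
    simp only [nextQueue, nextVisited, if_pos hN] at hv1
    have hc4 := hins u v {x, y}
    rw [hc2] at hc4
    have hc4' : ((insert u (insert v ({x, y} : Finset (Fin n)))).card : ℝ) ≤ 4 := by
      exact_mod_cast hc4
    simp only [List.singleton_append] at hv1 ⊢
    refine ExtinctionBound.mono (ExtinctionBound.step hn hv1
      (B₁ := (t * q) ^ 3) (B₂ := (t * q) ^ 2) (by positivity) (by positivity) ?_ ?_) ?_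
    · intro u' v' hN'
      have hv2 := hv1.next u' v'
      simp only [nextQueue, nextVisited, if_pos hN'] at hv2
      refine extinctionBound_of_capacity hn (subtreeSize k) t 3 _ _ hv2 ?_ ?_ (hq' _ ?_)
      · intro e he
        rcases List.mem_append.1 he with he | he
        · exact hsize _ _ e he
        · exact hsize _ _ e he
      · have h1 := hcap u v
        have h2 := hcap u' v'
        simp only [capacity, List.map_append, List.sum_append] at h1 h2 ⊢
        omega
      · exact (hins _ _ _).trans (by omega)
    · refine extinctionBound_of_capacity hn (subtreeSize k) t 2 _ _ hv1.tail (hsize _ _) ?_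
        (hq' _ (by omega))
      have h1 := hcap u v
      omega
    · gcongr
      linarith
  · refine ExtinctionBound.mono (ExtinctionBound.step hn hv0.tail
      (B₁ := (t * q) ^ 2) (B₂ := 1) (by positivity) zero_le_one ?_
      (extinctionBound_one _ _ _)) ?_
    · intro u v hN
      have hv1 := hv0.tail.next u v
      simp only [nextQueue, nextVisited, if_pos hN] at hv1
      refine extinctionBound_of_capacity hn (subtreeSize k) t 2 _ _ hv1 ?_ ?_ (hq' _ ?_)
      · exact hsize _ _
      · have h1 := hcap u v
        simp only [List.nil_append] at h1 ⊢
        omega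
      · exact (hins _ _ _).trans (by omega)
    · rw [hc2, mul_one]
      push_cast
      gcongr
      norm_num
  · rw [hc2]
    push_cast
    gcongr
    norm_num

/-- Each query on a red pair doubles the stake if its outcome lies in `L`; otherwise the stake is
lost. -/
noncomputable def stake (col : Fin n × Bool → Bool) (L : Finset (Fin n × Fin n))
    (δ : Fin n × Bool → Fin n) (l : List (PairQuery n)) : ℝ :=
  (l.map fun e => if col e.leftCoord ∧ col e.rightCoord then
    (if (δ e.leftCoord, δ e.rightCoord) ∈ L then 2 else 0) else 1).prod

theorem prodExp_stake_le (hn : 0 < n) (col : Fin n × Bool → Bool) (L : Finset (Fin n × Fin n))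
    (hL : (L.card : ℝ) ≤ (n : ℝ) ^ 2 / 2) (r : ℕ) :
    ∀ (s : List (PairQuery n)) (V : Finset (Fin n)), Valid s V →
      ∀ h : (Fin n × Bool → Fin n) → ℝ, (∀ δ, 0 ≤ h δ) →
        (∀ i, Fresh s V i → col i → ∀ δ b, h (Function.update δ i b) = h δ) →
        prodExp (unif n) (fun δ => h δ * stake col L δ (explore δ r s V)) ≤
          prodExp (unif n) h := by
  have hn' : (0 : ℝ) < n := by positivity
  induction r with
  | zero => intro s V _ h _ _; simp [explore, stake]
  | succ r ih =>
    intro s V hv h hh hinv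
    cases s with
    | nil => simp [explore, stake]
    | cons e s =>
      set c : Fin n → Fin n → ℝ := fun u v => if col e.leftCoord ∧ col e.rightCoord then
        (if (u, v) ∈ L then 2 else 0) else 1 with hc
      have hc0 : ∀ u v, 0 ≤ c u v := by
        intro u v
        simp only [hc]
        split_ifs <;> norm_num
      have hsplit : prodExp (unif n)
          (fun δ => h δ * stake col L δ (explore δ (r + 1) (e :: s) V)) =
          ∑ u, ∑ v, prodExp (unif n) (fun δ =>
            (if δ e.leftCoord = u ∧ δ e.rightCoord = v then 1 else 0) * (h δ * (c u v *
              stake col L δ (explore δ r (nextQueue e.budget s V u v) (nextVisited V u v))))) := by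
        rw [← prodExp_split e.leftCoord e.rightCoord fun u v δ => h δ * (c u v *
              stake col L δ (explore δ r (nextQueue e.budget s V u v) (nextVisited V u v)))]
        simp only [explore, stake, List.map_cons, List.prod_cons, hc]
      have hbound : ∀ u v, prodExp (unif n) (fun δ =>
            (if δ e.leftCoord = u ∧ δ e.rightCoord = v then 1 else 0) * (h δ * (c u v *
              stake col L δ (explore δ r (nextQueue e.budget s V u v) (nextVisited V u v))))) ≤
          c u v * prodExp (unif n)
            (fun δ => h δ * if δ e.leftCoord = u ∧ δ e.rightCoord = v then 1 else 0) := by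
        intro u v
        have := ih _ _ (hv.next u v)
          (fun δ => h δ * if δ e.leftCoord = u ∧ δ e.rightCoord = v then 1 else 0)
          (fun δ => mul_nonneg (hh δ) (by split_ifs <;> norm_num)) (by
            intro i hi hci δ b
            obtain ⟨h1, h2, h3⟩ := Fresh.of_next hv hi
            simp only [hinv i h1 hci, Function.update_of_ne h2.symm,
              Function.update_of_ne h3.symm])
        refine le_trans (le_of_eq ?_) (mul_le_mul_of_nonneg_left this (hc0 u v))
        rw [← prodExp_const_mul]
        congr 1
        funext δ
        ring
      rw [hsplit]
      refine (Finset.sum_le_sum fun u _ => Finset.sum_le_sum fun v _ => hbound u v).trans ?_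
      by_cases hred : col e.leftCoord ∧ col e.rightCoord
      · have hE := prodExp_nonneg (unif_nonneg n) hh
        simp only [prodExp_mul_indicator (sum_unif hn) hv.left_ne_right
          (hinv _ (fresh_leftCoord e s V) hred.1) (hinv _ (fresh_rightCoord e s V) hred.2)]
        simp only [hc, if_pos hred, unif, ← Finset.sum_mul]
        have hcount : ∑ u : Fin n, ∑ v : Fin n, (if (u, v) ∈ L then (2 : ℝ) else 0) =
            2 * L.card := by
          rw [← Fintype.sum_prod_type' (f := fun u v => if (u, v) ∈ L then (2 : ℝ) else 0)]
          simp [mul_comm]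
        rw [hcount, ← mul_assoc]
        refine mul_le_of_le_one_left hE ?_
        rw [← mul_assoc, mul_one_div, mul_one_div, div_div, div_le_one (by positivity)]
        nlinarith
      · simp only [hc, if_neg hred, one_mul]
        have := prodExp_split (μ := unif n) e.leftCoord e.rightCoord fun _ _ δ => h δ
        rw [this]
        refine le_of_eq (Finset.sum_congr rfl fun u _ => Finset.sum_congr rfl fun v _ => ?_)
        congr 1
        funext δ
        ring

theorem prodExp_half_pow (p : ℝ) (l : List (PairQuery n)) (hl : (coords l).Nodup) :
    prodExp (colorWeight p) (fun col : Fin n × Bool → Bool =>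
      (l.map fun e => if col e.leftCoord ∧ col e.rightCoord then (1 / 2 : ℝ) else 1).prod) =
      (1 - p ^ 2 / 2) ^ l.length := by
  induction l with
  | nil => simpa using prodExp_const (sum_colorWeight p) 1
  | cons e l ih =>
    simp only [coords_cons, List.nodup_cons, List.mem_cons, not_or] at hl
    obtain ⟨⟨hne, hl1⟩, hl2, hnd⟩ := hl
    have hinv : ∀ i, i ∉ coords l → ∀ (col : Fin n × Bool → Bool) (b : Bool),
        (l.map fun e => if Function.update col i b e.leftCoord ∧
          Function.update col i b e.rightCoord then (1 / 2 : ℝ) else 1).prod =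
        (l.map fun e => if col e.leftCoord ∧ col e.rightCoord then (1 / 2 : ℝ) else 1).prod := by
      intro i hi col b
      congr 1
      refine List.map_congr_left fun f hf => ?_
      have hmem : f.leftCoord ∈ coords l ∧ f.rightCoord ∈ coords l := by
        simp only [coords, List.mem_flatMap]
        exact ⟨⟨f, hf, by simp⟩, ⟨f, hf, by simp⟩⟩
      rw [Function.update_of_ne (ne_of_mem_of_not_mem hmem.1 hi),
        Function.update_of_ne (ne_of_mem_of_not_mem hmem.2 hi)]
    have := prodExp_mul_of_invariant (sum_colorWeight p) hne (h := fun col => (l.map fun e =>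
      if col e.leftCoord ∧ col e.rightCoord then (1 / 2 : ℝ) else 1).prod) (hinv _ hl1) (hinv _ hl2)
      fun a b => if a ∧ b then (1 / 2 : ℝ) else 1
    have hpair : (∑ a, ∑ b, colorWeight p a * colorWeight p b *
        if a ∧ b then (1 / 2 : ℝ) else 1) = 1 - p ^ 2 / 2 := by
      simp [colorWeight]
      ring
    rw [ih hnd, hpair] at this
    rw [List.length_cons, pow_succ', ← this]
    congr 1
    funext col
    rw [List.map_cons, List.prod_cons, mul_comm]

end PairQuery

theorem usedPairs_run_update {n : ℕ} {col : Fin n × Bool → Bool} {i : Fin n × Bool}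
    (hi : col i) (δ : Fin n × Bool → Fin n) (b : Fin n) (ω : List Bool) :
    ∀ x, (∀ pr ∈ usedPairs δ ω x, col pr = false) →
      usedPairs (Function.update δ i b) ω x = usedPairs δ ω x ∧
        run (Function.update δ i b) ω x = run δ ω x := by
  induction ω with
  | nil => intro x _; exact ⟨rfl, rfl⟩
  | cons c ω ih =>
    intro x h
    simp only [usedPairs, List.mem_cons, forall_eq_or_imp] at h
    have hne : (x, c) ≠ i := by
      rintro rfl
      simp [hi] at h
    simp only [usedPairs, run, Function.update_of_ne hne]
    exact ⟨congrArg _ (ih _ h.2).1, (ih _ h.2).2⟩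

/-- Changing a red transition does not affect `Lb`. -/
theorem Lb_update {n : ℕ} {col : Fin n × Bool → Bool} {i : Fin n × Bool}
    (hi : col i) (δ : Fin n × Bool → Fin n) (b : Fin n) :
    Lb n (Function.update δ i b) col = Lb n δ col := by
  have key : ∀ (δ : Fin n × Bool → Fin n) (b : Fin n),
      Lb n (Function.update δ i b) col ⊆ Lb n δ col := by
    intro δ b z hz
    simp only [Lb, Finset.mem_filter, Finset.mem_univ, true_and] at hz ⊢
    rintro ⟨ω, hlen, hrun, hblue⟩
    have h1 := usedPairs_run_update hi δ b ω z.1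
      fun pr hpr => hblue pr (List.mem_append_left _ hpr)
    have h2 := usedPairs_run_update hi δ b ω z.2
      fun pr hpr => hblue pr (List.mem_append_right _ hpr)
    exact hz ⟨ω, hlen, by rw [h1.2, h2.2, hrun], by rwa [h1.1, h2.1]⟩
  refine (key δ b).antisymm ?_
  simpa using key (Function.update δ i b) (δ i)

namespace PairQuery

variable {n : ℕ}

theorem prodExp_stake_Lb_le (hn : 0 < n) (col : Fin n × Bool → Bool) (r : ℕ)
    {s : List (PairQuery n)} {V : Finset (Fin n)} (hv : Valid s V) :
    prodExp (unif n) (fun δ => (if ((Lb n δ col).card : ℝ) < (n : ℝ) ^ 2 / 2 then 1 else 0) *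
      stake col (Lb n δ col) δ (explore δ r s V)) ≤ 1 := by
  let h : Finset (Fin n × Fin n) → (Fin n × Bool → Fin n) → ℝ := fun L δ =>
    if Lb n δ col = L ∧ (L.card : ℝ) < (n : ℝ) ^ 2 / 2 then 1 else 0
  have hsum : ∀ δ, ∑ L, h L δ = if ((Lb n δ col).card : ℝ) < (n : ℝ) ^ 2 / 2 then 1 else 0 := by
    intro δ
    simp only [h, ite_and, Finset.sum_ite_eq, Finset.mem_univ, if_true]
  calc _ = ∑ L, prodExp (unif n) (fun δ => h L δ * stake col L δ (explore δ r s V)) := by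
        rw [← prodExp_sum]
        congr 1
        funext δ
        simp only [h, ite_and, ite_mul, zero_mul, Finset.sum_ite_eq, Finset.mem_univ, if_true]
    _ ≤ ∑ L, prodExp (unif n) (h L) := by
        refine Finset.sum_le_sum fun L _ => ?_
        by_cases hL : (L.card : ℝ) < (n : ℝ) ^ 2 / 2
        · refine prodExp_stake_le hn col L hL.le r s V hv (h L) ?_ ?_
          · intro δ
            simp only [h]
            split_ifs <;> norm_num
          · intro i _ hi δ b
            simp only [h, Lb_update hi]
        · simp [h, hL]
    _ = prodExp (unif n) fun δ => ∑ L, h L δ := (prodExp_sum _ _).symm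
    _ ≤ prodExp (unif n) fun _ => 1 := by
        refine prodExp_mono (unif_nonneg n) fun δ => ?_
        rw [hsum]
        split_ifs <;> norm_num
    _ = 1 := prodExp_const (sum_unif hn) 1

theorem half_pow_mul_stake (col : Fin n × Bool → Bool) (L : Finset (Fin n × Fin n))
    (δ : Fin n × Bool → Fin n) (l : List (PairQuery n))
    (hl : ∀ e ∈ l, (δ e.leftCoord, δ e.rightCoord) ∈ L) :
    (l.map fun e => if col e.leftCoord ∧ col e.rightCoord then (1 / 2 : ℝ) else 1).prod *
      stake col L δ l = 1 := by
  induction l with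
  | nil => simp [stake]
  | cons e l ih =>
    have h1 := hl e (by simp)
    have h2 := ih fun f hf => hl f (by simp [hf])
    simp only [stake, List.map_cons, List.prod_cons, h1, if_true] at h2 ⊢
    rw [mul_mul_mul_comm, h2]
    split_ifs <;> norm_num

theorem stake_nonneg (col : Fin n × Bool → Bool) (L : Finset (Fin n × Fin n))
    (δ : Fin n × Bool → Fin n) (l : List (PairQuery n)) : 0 ≤ stake col L δ l := by
  refine List.prod_nonneg fun a ha => ?_
  obtain ⟨e, -, rfl⟩ := List.mem_map.1 ha
  split_ifs <;> norm_num

theorem half_pow_nonneg (col : Fin n × Bool → Bool) (l : List (PairQuery n)) :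
    0 ≤ (l.map fun e =>
      if col e.leftCoord ∧ col e.rightCoord then (1 / 2 : ℝ) else 1).prod := by
  refine List.prod_nonneg fun a ha => ?_
  obtain ⟨e, -, rfl⟩ := List.mem_map.1 ha
  split_ifs <;> norm_num

/-- If `x` and `y` cannot be merged quickly, every explored pair leads into `Lb`. -/
theorem outcome_mem_Lb {δ : Fin n × Bool → Fin n} {x y : Fin n} {k : ℕ}
    (hk : (k + 2 : ℝ) ≤ Real.logb 2 n / 2)
    (hxy : ¬ ∃ ω : List Bool, (ω.length : ℝ) ≤ 2.5 * Real.logb 2 n ∧ run δ ω x = run δ ω y)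
    (col : Fin n × Bool → Bool) (r : ℕ) :
    ∀ e ∈ explore δ r (children x y (k + 2)) {x, y},
      (δ e.leftCoord, δ e.rightCoord) ∈ Lb n δ col := by
  intro e he
  obtain ⟨w, hw, hx, hy⟩ := exists_word_of_mem_explore δ x y (k + 2) r _ _ (by
    intro f hf
    simp only [children, List.mem_cons, List.not_mem_nil, or_false] at hf
    refine ⟨[], ?_⟩
    rcases hf with rfl | rfl <;> simp [run]) e he
  by_contra hL
  simp only [Lb, Finset.mem_filter, Finset.mem_univ, true_and, not_not] at hL
  obtain ⟨ω, hlen, hrun, -⟩ := hL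
  refine hxy ⟨w ++ e.letter :: ω, ?_, ?_⟩
  · have hw' : ((w.length + 1 : ℕ) : ℝ) ≤ ((k + 2 : ℕ) : ℝ) := by
      exact_mod_cast (by omega : w.length + 1 ≤ k + 2)
    push_cast [List.length_append, List.length_cons] at hw' ⊢
    linarith
  · rw [run_append, run_append, hx, hy]
    exact hrun

theorem one_sub_le_prodExp {x y : Fin n} (hxy : x ≠ y) (hn : 0 < n) {p : ℝ}
    (hp0 : 0 ≤ p) (hp1 : p ≤ 1) {t k : ℕ} (hk : (k + 2 : ℝ) ≤ Real.logb 2 n / 2)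
    (ht : t ≤ subtreeSize k) {q : ℝ} (hq : (4 * t + 13 : ℝ) / n ≤ q) :
    1 - ((((t * q) ^ 3 + 9 / n * (t * q) ^ 2) + 5 / n * ((t * q) ^ 2 + 5 / n)) +
        n ^ 2 * (1 - p ^ 2 / 2) ^ (t + 2) + 1 / n ^ 2) ≤
      prodExp (unif n) fun δ => prodExp (colorWeight p) fun col =>
        if (∃ ω : List Bool, (ω.length : ℝ) ≤ 2.5 * Real.logb 2 n ∧ run δ ω x = run δ ω y) ∨
          (n : ℝ) ^ 2 / 2 ≤ ((Lb n δ col).card : ℝ) then (1 : ℝ) else 0 := by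
  have hn' : (0 : ℝ) < n := by positivity
  have hcw : ∀ b, 0 ≤ colorWeight p b := by
    intro b
    unfold colorWeight
    split_ifs <;> linarith
  have hone : 0 ≤ 1 - p ^ 2 / 2 := by nlinarith
  have hv := valid_children hxy (k + 2)
  set l : (Fin n × Bool → Fin n) → List (PairQuery n) := fun δ =>
    explore δ (t + 2) (children x y (k + 2)) {x, y} with hl
  let die : (Fin n × Bool → Fin n) → ℝ := fun δ => if (l δ).length < t + 2 then 1 else 0
  let half : (Fin n × Bool → Fin n) → (Fin n × Bool → Bool) → ℝ := fun δ col =>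
    ((l δ).map fun e => if col e.leftCoord ∧ col e.rightCoord then (1 / 2 : ℝ) else 1).prod
  let lost : (Fin n × Bool → Fin n) → (Fin n × Bool → Bool) → ℝ := fun δ col =>
    (if ((Lb n δ col).card : ℝ) < (n : ℝ) ^ 2 / 2 then 1 else 0) *
      stake col (Lb n δ col) δ (l δ)
  let good : (Fin n × Bool → Fin n) → (Fin n × Bool → Bool) → ℝ := fun δ col =>
    if (∃ ω : List Bool, (ω.length : ℝ) ≤ 2.5 * Real.logb 2 n ∧ run δ ω x = run δ ω y) ∨
      (n : ℝ) ^ 2 / 2 ≤ ((Lb n δ col).card : ℝ) then (1 : ℝ) else 0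
  have hdie0 : ∀ δ, 0 ≤ die δ ∧ 0 ≤ 1 - die δ := by
    intro δ
    simp only [die]
    split_ifs <;> norm_num
  have hhalf0 : ∀ δ col, 0 ≤ half δ col := fun δ col => half_pow_nonneg col _
  have hlost0 : ∀ δ col, 0 ≤ lost δ col := fun δ col =>
    mul_nonneg (by split_ifs <;> norm_num) (stake_nonneg _ _ _ _)
  have hpoint : ∀ δ col,
      1 ≤ good δ col + (die δ + (n ^ 2 * (1 - die δ)) * half δ col + 1 / n ^ 2 * lost δ col) := by
    intro δ col
    have h1 : 0 ≤ (n ^ 2 * (1 - die δ)) * half δ col :=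
      mul_nonneg (mul_nonneg (by positivity) (hdie0 δ).2) (hhalf0 δ col)
    have h2 : 0 ≤ 1 / (n : ℝ) ^ 2 * lost δ col := mul_nonneg (by positivity) (hlost0 δ col)
    have h3 := (hdie0 δ).1
    by_cases hg : (∃ ω : List Bool, (ω.length : ℝ) ≤ 2.5 * Real.logb 2 n ∧
        run δ ω x = run δ ω y) ∨ (n : ℝ) ^ 2 / 2 ≤ ((Lb n δ col).card : ℝ)
    · have : good δ col = 1 := if_pos hg
      linarith
    have hgood0 : good δ col = 0 := if_neg hg
    rw [hgood0]
    by_cases hd : (l δ).length < t + 2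
    · have : die δ = 1 := if_pos hd
      linarith
    have hd0 : die δ = 0 := if_neg hd
    simp only [not_or, not_le] at hg
    have hprod : half δ col * lost δ col = 1 := by
      simp only [half, lost, if_pos hg.2, one_mul]
      exact half_pow_mul_stake col _ δ _ (outcome_mem_Lb hk hg.1 col (t + 2))
    rw [hd0]
    set a : ℝ := (n : ℝ) ^ 2 * half δ col with ha
    set b : ℝ := 1 / (n : ℝ) ^ 2 * lost δ col with hb
    have hab : a * b = 1 := by
      rw [ha, hb, mul_mul_mul_comm, hprod]
      field_simp
    have ha0 : 0 ≤ a := mul_nonneg (by positivity) (hhalf0 δ col)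
    have : 1 ≤ a + b := by nlinarith [sq_nonneg (a - b)]
    linarith
  have hmono : (1 : ℝ) ≤ prodExp (unif n) fun δ => prodExp (colorWeight p) fun col =>
      good δ col + (die δ + (n ^ 2 * (1 - die δ)) * half δ col + 1 / n ^ 2 * lost δ col) := by
    calc (1 : ℝ) = prodExp (unif n) fun _ : Fin n × Bool → Fin n =>
          prodExp (colorWeight p) fun _ : Fin n × Bool → Bool => (1 : ℝ) := by
          rw [prodExp_const (sum_colorWeight p), prodExp_const (sum_unif hn)]
      _ ≤ _ := prodExp_mono (unif_nonneg n) fun δ => prodExp_mono hcw fun col => hpoint δ col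
  simp only [prodExp_add, prodExp_const_mul, prodExp_const (sum_colorWeight p)] at hmono
  have hdie : prodExp (unif n) die ≤
      (((t * q) ^ 3 + 9 / n * (t * q) ^ 2) + 5 / n * ((t * q) ^ 2 + 5 / n)) := by
    have := extinctionBound_children hn hxy ht hq (fun _ => 1) (fun _ => zero_le_one)
      (fun _ _ _ _ => rfl)
    rw [prodExp_const (sum_unif hn), mul_one] at this
    simpa only [one_mul] using this
  have hhalf : prodExp (unif n)
      (fun δ => n ^ 2 * (1 - die δ) * prodExp (colorWeight p) (half δ)) ≤
      n ^ 2 * (1 - p ^ 2 / 2) ^ (t + 2) := by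
    rw [← prodExp_const (sum_unif hn) (ι := Fin n × Bool) (n ^ 2 * (1 - p ^ 2 / 2) ^ (t + 2))]
    refine prodExp_mono (unif_nonneg n) fun δ => ?_
    have hA : prodExp (colorWeight p) (half δ) = (1 - p ^ 2 / 2) ^ (l δ).length :=
      prodExp_half_pow p (l δ) (explore_coords δ (t + 2) _ _ hv).1
    rw [hA]
    by_cases hd : (l δ).length < t + 2
    · have : die δ = 1 := if_pos hd
      rw [this, sub_self, mul_zero, zero_mul]
      positivity
    · have : die δ = 0 := if_neg hd
      rw [this, sub_zero, mul_one]
      gcongr ?_ * ?_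
      exact pow_le_pow_of_le_one hone (by nlinarith) (not_lt.1 hd)
  have hlost : prodExp (unif n) (fun δ => prodExp (colorWeight p) (lost δ)) ≤ 1 := by
    rw [prodExp_comm, ← prodExp_const (sum_colorWeight p) (ι := Fin n × Bool) 1]
    exact prodExp_mono hcw fun col => prodExp_stake_Lb_le hn col (t + 2) hv
  have hlost' : 1 / (n : ℝ) ^ 2 * prodExp (unif n) (fun δ => prodExp (colorWeight p) (lost δ)) ≤
      1 / n ^ 2 := mul_le_of_le_one_right (by positivity) hlost
  change _ ≤ prodExp (unif n) fun δ => prodExp (colorWeight p) (good δ)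
  linarith

end PairQuery

theorem eventually_logb_pow_le :
    ∀ᶠ n : ℕ in Filter.atTop,
      4 ≤ Real.logb 2 n ∧ 10 ^ 9 * (Real.logb 2 n ^ 10) ^ 3 ≤ (n : ℝ) := by
  have h4 : ∀ᶠ n : ℕ in Filter.atTop, 4 ≤ Real.logb 2 n :=
    ((Real.tendsto_logb_atTop one_lt_two).comp tendsto_natCast_atTop_atTop).eventually_ge_atTop 4
  have hlog2 : 0 < Real.log 2 := Real.log_pos one_lt_two
  have ho := ((Real.isLittleO_pow_log_id_atTop (n := 30)).comp_tendsto
    (tendsto_natCast_atTop_atTop (R := ℝ))).def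
      (show (0 : ℝ) < Real.log 2 ^ 30 / 10 ^ 9 by positivity)
  filter_upwards [h4, ho] with n h4 ho
  refine ⟨h4, ?_⟩
  simp only [Function.comp, id, Real.norm_eq_abs, abs_pow, Nat.abs_cast] at ho
  rw [Even.pow_abs (by decide)] at ho
  rw [← pow_mul, Real.logb, div_pow]
  have : (0 : ℝ) < Real.log 2 ^ 30 := by positivity
  calc (10 : ℝ) ^ 9 * (Real.log n ^ (10 * 3) / Real.log 2 ^ (10 * 3))
      ≤ 10 ^ 9 * (Real.log 2 ^ 30 / 10 ^ 9 * n / Real.log 2 ^ (10 * 3)) := by gcongr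
    _ = (n : ℝ) := by
          field_simp
          norm_num
          ring

theorem sq_mul_one_sub_pow_le {n m : ℕ} (hn : 2 ≤ n)
    (hm : 8 * Real.logb 2 n ^ 5 ≤ m) :
    (n : ℝ) ^ 2 * (1 - (1 / Real.logb 2 n ^ 2) ^ 2 / 2) ^ m ≤ 1 / (n : ℝ) ^ 2 := by
  have hn' : (2 : ℝ) ≤ n := by exact_mod_cast hn
  have hn0 : (0 : ℝ) < n := by linarith
  have hlog : 0 < Real.log n := Real.log_pos (by linarith)
  set l := Real.logb 2 n with hl
  have hl1 : 1 ≤ l := by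
    rw [hl, Real.le_logb_iff_rpow_le one_lt_two hn0]
    simpa using hn'
  have hll : Real.log n ≤ l := by
    rw [hl, Real.logb]
    exact le_div_self hlog.le (Real.log_pos one_lt_two)
      (Real.log_two_lt_d9.le.trans (by norm_num))
  have hp : (1 / l ^ 2) ^ 2 ≤ 1 := by
    rw [div_pow, one_pow]
    exact div_le_one_of_le₀ (one_le_pow₀ (one_le_pow₀ hl1)) (by positivity)
  have h1 : (1 - (1 / l ^ 2) ^ 2 / 2) ^ m ≤ Real.exp (-(4 * Real.log n)) := by
    calc (1 - (1 / l ^ 2) ^ 2 / 2) ^ m ≤ Real.exp (-((1 / l ^ 2) ^ 2 / 2)) ^ m := by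
          gcongr
          · linarith
          · exact Real.one_sub_le_exp_neg _
      _ = Real.exp (-(m * ((1 / l ^ 2) ^ 2 / 2))) := by
          rw [← Real.exp_nat_mul]
          ring_nf
      _ ≤ Real.exp (-(4 * Real.log n)) := by
          refine Real.exp_le_exp.2 (neg_le_neg ?_)
          calc 4 * Real.log n ≤ 4 * l := by gcongr
            _ = 8 * l ^ 5 * ((1 / l ^ 2) ^ 2 / 2) := by
                field_simp
                norm_num
            _ ≤ m * ((1 / l ^ 2) ^ 2 / 2) := by gcongr
  have h2 : Real.exp (-(4 * Real.log n)) = 1 / (n : ℝ) ^ 4 := by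
    rw [Real.exp_neg, show (4 : ℝ) * Real.log n = ((4 : ℕ) : ℝ) * Real.log n by norm_num,
      Real.exp_nat_mul, Real.exp_log hn0, one_div]
  calc _ ≤ (n : ℝ) ^ 2 * (1 / (n : ℝ) ^ 4) := by
        rw [← h2]
        gcongr
    _ = _ := by field_simp

theorem one_sub_le_prodExp_of_large {n : ℕ} (hn : 2 ≤ n) (h4 : 4 ≤ Real.logb 2 n)
    (hlarge : 10 ^ 9 * (Real.logb 2 n ^ 10) ^ 3 ≤ (n : ℝ)) {x y : Fin n} (hxy : x ≠ y) :
    1 - 29 / (n : ℝ) ^ 2 ≤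
      prodExp (unif n) fun δ => prodExp (colorWeight (1 / Real.logb 2 n ^ 2)) fun col =>
        if (∃ ω : List Bool, (ω.length : ℝ) ≤ 2.5 * Real.logb 2 n ∧ run δ ω x = run δ ω y) ∨
          (n : ℝ) ^ 2 / 2 ≤ ((Lb n δ col).card : ℝ) then (1 : ℝ) else 0 := by
  have hn0 : (0 : ℝ) < n := by positivity
  set l := Real.logb 2 n with hl
  have hl5 : 1 ≤ l ^ 5 := one_le_pow₀ (by linarith)
  have hX : 1 ≤ l ^ 10 := one_le_pow₀ (by linarith)
  set t := ⌈8 * l ^ 5⌉₊ with ht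
  have ht1 : 8 * l ^ 5 ≤ t := Nat.le_ceil _
  have ht2 : (t : ℝ) ≤ 9 * l ^ 5 := by
    have := Nat.ceil_lt_add_one (show 0 ≤ 8 * l ^ 5 by positivity)
    linarith
  obtain ⟨k, hk⟩ : ∃ k, ⌊l / 2⌋₊ = k + 2 :=
    Nat.exists_eq_add_of_le' (Nat.le_floor (by push_cast; linarith))
  have hk1 : (k + 2 : ℝ) ≤ l / 2 := by
    have := Nat.floor_le (show 0 ≤ l / 2 by linarith)
    rw [hk] at this
    exact_mod_cast this
  have hk2 : l / 2 ≤ k + 3 := by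
    have := (Nat.lt_floor_add_one (l / 2)).le
    rw [hk] at this
    push_cast at this
    linarith
  have hsize : t ≤ PairQuery.subtreeSize k := by
    have hpow : (n : ℝ) ≤ (4 * 2 ^ (k + 1)) ^ 2 := by
      calc (n : ℝ) = 2 ^ l := (Real.rpow_logb two_pos (by norm_num) hn0).symm
        _ ≤ 2 ^ (((k + 3) * 2 : ℕ) : ℝ) := by
          refine Real.rpow_le_rpow_of_exponent_le one_le_two ?_
          push_cast
          linarith
        _ = (4 * 2 ^ (k + 1)) ^ 2 := by
          rw [Real.rpow_natCast]
          ring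
    have hsq : (4 * (t + 1 : ℝ)) ^ 2 ≤ n := by
      calc (4 * (t + 1 : ℝ)) ^ 2 ≤ (4 * (10 * l ^ 5)) ^ 2 := by
            gcongr
            linarith
        _ = 1600 * l ^ 10 := by ring
        _ ≤ 10 ^ 9 * (l ^ 10) ^ 3 := by
            gcongr
            · norm_num
            · exact le_self_pow₀ hX (by norm_num)
        _ ≤ n := hlarge
    have h5 : 4 * (t + 1 : ℝ) ≤ 4 * 2 ^ (k + 1) :=
      (sq_le_sq₀ (by positivity) (by positivity)).1 (hsq.trans hpow)
    have h6 : t + 1 ≤ 2 ^ (k + 1) := by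
      have : (t + 1 : ℝ) ≤ 2 ^ (k + 1) := by linarith
      exact_mod_cast this
    unfold PairQuery.subtreeSize
    omega
  have hp1 : 1 / l ^ 2 ≤ 1 :=
    div_le_one_of_le₀ (one_le_pow₀ (by linarith)) (by positivity)
  refine le_trans ?_ (PairQuery.one_sub_le_prodExp hxy (by omega) (by positivity) hp1 hk1 hsize
    (q := 49 * l ^ 5 / n) (by gcongr; linarith))
  have hpow := sq_mul_one_sub_pow_le hn (m := t + 2) (by push_cast; linarith)
  have htq : (t : ℝ) * (49 * l ^ 5 / n) ≤ 441 * l ^ 10 / n := by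
    calc (t : ℝ) * (49 * l ^ 5 / n) ≤ 9 * l ^ 5 * (49 * l ^ 5 / n) := by gcongr
      _ = _ := by ring
  have h3 : ((t : ℝ) * (49 * l ^ 5 / n)) ^ 3 ≤ 1 / n ^ 2 := by
    calc _ ≤ (441 * l ^ 10 / n) ^ 3 := by gcongr
      _ = 85766121 * (l ^ 10) ^ 3 / n * (1 / n ^ 2) := by field_simp; norm_num
      _ ≤ 1 * (1 / n ^ 2) := by
        gcongr
        rw [div_le_one hn0]
        refine le_trans ?_ hlarge
        gcongr
        norm_num
      _ = _ := one_mul _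
  have h2 : 14 / n * ((t : ℝ) * (49 * l ^ 5 / n)) ^ 2 ≤ 1 / n ^ 2 := by
    calc _ ≤ 14 / n * (441 * l ^ 10 / n) ^ 2 := by gcongr
      _ = 2722734 * (l ^ 10) ^ 2 / n * (1 / n ^ 2) := by field_simp; norm_num
      _ ≤ 1 * (1 / n ^ 2) := by
        gcongr
        rw [div_le_one hn0]
        refine le_trans ?_ hlarge
        gcongr
        · norm_num
        · norm_num
      _ = _ := one_mul _
  have hsum : 29 / (n : ℝ) ^ 2 = 1 / n ^ 2 + 1 / n ^ 2 + 5 / n * (5 / n) + 1 / n ^ 2 + 1 / n ^ 2 := by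
    field_simp
    norm_num
  have hsplit : 14 / (n : ℝ) * ((t : ℝ) * (49 * l ^ 5 / n)) ^ 2 =
      9 / n * ((t : ℝ) * (49 * l ^ 5 / n)) ^ 2 + 5 / n * ((t : ℝ) * (49 * l ^ 5 / n)) ^ 2 := by
    ring
  rw [hsum]
  linarith

/-- There is a constant `C > 0` such that for every `n ≥ 2` and
every fixed pair of states `x, y`, for a uniformly random automaton together
with an independent red/blue coloring (each pair red with probability
`p = 1/(log₂ n)²`), with probability at least `1 − C/n²` either
`d(x,y) ≤ 2.5·log₂ n` or `|L_b| ≥ n²/2`. -/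
theorem pair_short_or_Lb_large :
    ∃ C : ℝ, 0 < C ∧ ∀ n : ℕ, 2 ≤ n → ∀ x y : Fin n,
      1 - C / (n : ℝ) ^ 2 ≤
        ∑ δ : Fin n × Bool → Fin n, ∑ col : Fin n × Bool → Bool,
          ((1 / (n : ℝ) ^ (2 * n)) *
            ∏ pr : Fin n × Bool,
              (if col pr then 1 / (Real.logb 2 n) ^ 2
                else 1 - 1 / (Real.logb 2 n) ^ 2)) *
          (if (∃ ω : List Bool, (ω.length : ℝ) ≤ 2.5 * Real.logb 2 n ∧
                  run δ ω x = run δ ω y) ∨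
                (n : ℝ) ^ 2 / 2 ≤ ((Lb n δ col).card : ℝ)
            then (1 : ℝ) else 0) := by
  obtain ⟨N, hN⟩ := Filter.eventually_atTop.1 eventually_logb_pow_le
  refine ⟨29 + (N : ℝ) ^ 2, by positivity, fun n hn x y => ?_⟩
  have hn' : (2 : ℝ) ≤ n := by exact_mod_cast hn
  have hn0 : (0 : ℝ) < n := by linarith
  have hl1 : 1 ≤ Real.logb 2 n := by
    rw [Real.le_logb_iff_rpow_le one_lt_two hn0]
    simpa using hn'
  have hp1 : 1 / Real.logb 2 n ^ 2 ≤ 1 :=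
    div_le_one_of_le₀ (one_le_pow₀ hl1) (by positivity)
  have hcw : ∀ b, 0 ≤ colorWeight (1 / Real.logb 2 n ^ 2) b := by
    intro b
    unfold colorWeight
    split_ifs
    · positivity
    · linarith
  have hweight : ∀ δ : Fin n × Bool → Fin n, ∏ i, unif n (δ i) = 1 / (n : ℝ) ^ (2 * n) := by
    intro δ
    simp [unif, mul_comm]
  suffices h : 1 - (29 + (N : ℝ) ^ 2) / (n : ℝ) ^ 2 ≤
      prodExp (unif n) fun δ => prodExp (colorWeight (1 / Real.logb 2 n ^ 2)) fun col =>
        if (∃ ω : List Bool, (ω.length : ℝ) ≤ 2.5 * Real.logb 2 n ∧ run δ ω x = run δ ω y) ∨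
          (n : ℝ) ^ 2 / 2 ≤ ((Lb n δ col).card : ℝ) then (1 : ℝ) else 0 by
    refine h.trans (le_of_eq ?_)
    simp only [prodExp, hweight, Finset.mul_sum, mul_assoc, colorWeight]
  have hsmaller : 1 - (29 + (N : ℝ) ^ 2) / (n : ℝ) ^ 2 ≤ 1 - 29 / (n : ℝ) ^ 2 := by
    gcongr
    linarith [sq_nonneg (N : ℝ)]
  rcases lt_or_ge n N with hlt | hge
  · have hlt' : (n : ℝ) ≤ N := by exact_mod_cast hlt.le
    have h1 : 1 ≤ (29 + (N : ℝ) ^ 2) / (n : ℝ) ^ 2 := by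
      rw [one_le_div (by positivity)]
      nlinarith
    exact (sub_nonpos.2 h1).trans (prodExp_nonneg (unif_nonneg n) fun δ =>
      prodExp_nonneg hcw fun col => by split_ifs <;> norm_num)
  by_cases hxy : x = y
  · subst hxy
    have hlen : ((([] : List Bool).length : ℕ) : ℝ) ≤ 2.5 * Real.logb 2 n := by
      simp only [List.length_nil, Nat.cast_zero]
      linarith
    have hex : ∃ ω : List Bool, (ω.length : ℝ) ≤ 2.5 * Real.logb 2 n := ⟨[], hlen⟩
    simp only [and_true, hex, true_or, if_true]
    rw [prodExp_const (sum_colorWeight _), prodExp_const (sum_unif (by omega))]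
    exact sub_le_self _ (by positivity)
  · obtain ⟨h4, hlarge⟩ := hN n hge
    exact hsmaller.trans (one_sub_le_prodExp_of_large hn h4 hlarge hxy)
end

section
/- Let n ≥ 1, let f : Fin n → Fin n be a uniformly random function, and let k ≥ 1 be an integer. Then the expected number of vertices x that are endpoints of a directed path of length k (i.e., there exist pairwise distinct v₀, …, v_k with f(v_i) = v_{i+1} for all i < k and v_k = x) is at most n · exp(−(k−1)²/(2n)). -/
open scoped BigOperators Classical

/-- `IsPathEndpoint f k x` says that `x` is the endpoint of a directed path of
length `k` in the functional digraph of `f`: there are pairwise distinct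
vertices `v₀, …, v_k` with `f(v_i) = v_{i+1}` for all `i < k` and `v_k = x`. -/
def IsPathEndpoint {V : Type*} (f : V → V) (k : ℕ) (x : V) : Prop :=
  ∃ v : Fin (k + 1) → V, Function.Injective v ∧
    (∀ i : Fin k, f (v i.castSucc) = v i.succ) ∧ v (Fin.last k) = x

/-- Prescribing the images along an injective path of length `k` leaves `n ^ (n - k)` functions
at most. -/
theorem card_maps_following_path_le {n k : ℕ} (v : Fin (k + 1) ↪ Fin n) :
    (Finset.univ.filter
      (fun f : Fin n → Fin n => ∀ i : Fin k, f (v i.castSucc) = v i.succ)).card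
      ≤ n ^ (n - k) := by
  let s : Finset (Fin n) := Finset.univ.image (fun i : Fin k => v i.castSucc)
  have hs : s.card = k :=
    (Finset.card_image_of_injective _
      (v.injective.comp (Fin.castSucc_injective k))).trans (Finset.card_fin k)
  have hcard : Fintype.card ({a // a ∈ sᶜ} → Fin n) = n ^ (n - k) := by
    rw [Fintype.card_fun, Fintype.card_fin, Fintype.card_coe, Finset.card_compl, hs,
      Fintype.card_fin]
  rw [← hcard, ← Finset.card_univ]
  refine Finset.card_le_card_of_injOn (fun f a => f a)
    (fun _ _ => Finset.mem_coe.2 (Finset.mem_univ _)) ?_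
  intro f hf g hg hfg
  simp only [Finset.coe_filter, Finset.mem_univ, true_and, Set.mem_ofPred_eq] at hf hg
  funext a
  by_cases ha : a ∈ s
  · obtain ⟨i, -, rfl⟩ := Finset.mem_image.1 ha
    exact (hf i).trans (hg i).symm
  · exact congrFun hfg ⟨a, Finset.mem_compl.2 ha⟩

/-- The endpoints of paths of length `k` are at most as many as the paths themselves. -/
theorem card_pathEndpoints_le_card_paths {n : ℕ} (f : Fin n → Fin n) (k : ℕ) :
    (Finset.univ.filter (fun x : Fin n => IsPathEndpoint f k x)).card
      ≤ (Finset.univ.filter (fun v : Fin (k + 1) ↪ Fin n =>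
          ∀ i : Fin k, f (v i.castSucc) = v i.succ)).card := by
  refine Finset.card_le_card_of_surjOn (fun v => v (Fin.last k)) ?_
  intro x hx
  obtain ⟨v, hv, hf, rfl⟩ := (Finset.mem_filter.1 (Finset.mem_coe.1 hx)).2
  exact ⟨⟨v, hv⟩, by simpa using hf, rfl⟩

theorem sum_card_pathEndpoints_le (n k : ℕ) :
    ∑ f : Fin n → Fin n, (Finset.univ.filter (fun x : Fin n => IsPathEndpoint f k x)).card
      ≤ n.descFactorial (k + 1) * n ^ (n - k) := by
  calc _ ≤ ∑ f : Fin n → Fin n, (Finset.univ.filter (fun v : Fin (k + 1) ↪ Fin n =>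
          ∀ i : Fin k, f (v i.castSucc) = v i.succ)).card :=
        Finset.sum_le_sum fun f _ => card_pathEndpoints_le_card_paths f k
    _ = ∑ v : Fin (k + 1) ↪ Fin n, (Finset.univ.filter (fun f : Fin n → Fin n =>
          ∀ i : Fin k, f (v i.castSucc) = v i.succ)).card := by
        simp only [Finset.card_filter]
        exact Finset.sum_comm
    _ ≤ ∑ _v : Fin (k + 1) ↪ Fin n, n ^ (n - k) :=
        Finset.sum_le_sum fun v _ => card_maps_following_path_le v
    _ = n.descFactorial (k + 1) * n ^ (n - k) := by
        rw [Finset.sum_const, Finset.card_univ, Fintype.card_embedding_eq, Fintype.card_fin,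
          Fintype.card_fin, smul_eq_mul]

theorem descFactorial_succ_le_pow_mul_exp {n : ℕ} (hn : 1 ≤ n) (k : ℕ) :
    (n.descFactorial (k + 1) : ℝ)
      ≤ (n : ℝ) ^ (k + 1) * Real.exp (-((k : ℝ) * (k + 1)) / (2 * n)) := by
  have hn0 : (0 : ℝ) < n := by exact_mod_cast hn
  induction k with
  | zero => simp
  | succ k ih =>
    have hstep : ((n - (k + 1) : ℕ) : ℝ) ≤ n * Real.exp (-((k : ℝ) + 1) / n) := by
      rcases le_total (k + 1) n with h | h
      · rw [Nat.cast_sub h]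
        have := mul_le_mul_of_nonneg_left (Real.add_one_le_exp (-((k : ℝ) + 1) / n)) hn0.le
        refine le_trans (le_of_eq ?_) this
        push_cast
        field_simp
        ring
      · rw [Nat.sub_eq_zero_of_le h, Nat.cast_zero]
        positivity
    rw [Nat.descFactorial_succ, Nat.cast_mul]
    refine (mul_le_mul hstep ih (by positivity) (by positivity)).trans (le_of_eq ?_)
    rw [mul_mul_mul_comm, ← Real.exp_add, ← pow_succ']
    congr 2
    push_cast
    field_simp
    ring

/-- For a uniformly random function `f : Fin n → Fin n` and
`k ≥ 1`, the expected number of endpoints of directed paths of length `k` is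
at most `n·exp(−(k−1)²/(2n))`. -/
theorem expected_path_endpoints_uniform_le
    (n : ℕ) (hn : 1 ≤ n) (k : ℕ) (hk : 1 ≤ k) :
    (∑ f : Fin n → Fin n,
        ((Finset.univ.filter (fun x : Fin n => IsPathEndpoint f k x)).card : ℝ))
      / (n : ℝ) ^ n
    ≤ n * Real.exp (-((k : ℝ) - 1) ^ 2 / (2 * n)) := by
  have hn0 : (0 : ℝ) < n := by exact_mod_cast hn
  have hk0 : (1 : ℝ) ≤ k := by exact_mod_cast hk
  have hsum : (∑ f : Fin n → Fin n,
        ((Finset.univ.filter (fun x : Fin n => IsPathEndpoint f k x)).card : ℝ))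
      ≤ n.descFactorial (k + 1) * (n : ℝ) ^ (n - k) := by
    exact_mod_cast sum_card_pathEndpoints_le n k
  rw [div_le_iff₀ (by positivity)]
  refine hsum.trans ?_
  rcases lt_or_ge n (k + 1) with h | h
  · rw [Nat.descFactorial_eq_zero_iff_lt.2 h, Nat.cast_zero, zero_mul]
    positivity
  · calc (n.descFactorial (k + 1) : ℝ) * (n : ℝ) ^ (n - k)
        ≤ ((n : ℝ) ^ (k + 1) * Real.exp (-((k : ℝ) * (k + 1)) / (2 * n))) * (n : ℝ) ^ (n - k) := by
          gcongr
          exact descFactorial_succ_le_pow_mul_exp hn k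
      _ = n * Real.exp (-((k : ℝ) * (k + 1)) / (2 * n)) * (n : ℝ) ^ n := by
          have hpow : (n : ℝ) ^ n = (n : ℝ) ^ k * (n : ℝ) ^ (n - k) := by
            rw [← pow_add, Nat.add_sub_cancel' (by omega)]
          rw [hpow]
          ring
      _ ≤ n * Real.exp (-((k : ℝ) - 1) ^ 2 / (2 * n)) * (n : ℝ) ^ n := by
          gcongr
          nlinarith
end

section
/- Let n ≥ 1, let f : Fin n → Fin n be a uniformly random function, and fix a state x ∈ Fin n. Then the probability that x is cyclic (i.e., f^[t](x) = x for some t ≥ 1) equals (1/n) · Σ_{t=0}^{n−1} Π_{i=1}^{t} (1 − i/n), where the inner product is 1 when t = 0. -/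
open scoped BigOperators Classical

open Function in
/-- Redefining `f` at the end of an injective orbit segment does not change the segment. -/
theorem iterate_update_eq {α : Type*} [DecidableEq α] {f : α → α} {x : α} {t : ℕ}
    (h : Set.InjOn (fun i => f^[i] x) (Set.Iic t)) (y : α) {i : ℕ} (hi : i ≤ t) :
    (update f (f^[t] x) y)^[i] x = f^[i] x := by
  induction i with
  | zero => rfl
  | succ k ih =>
    rw [iterate_succ_apply', ih (by omega), iterate_succ_apply', update_of_ne]
    intro hk
    have := h (Set.mem_Iic.2 (by omega : k ≤ t)) (Set.mem_Iic.2 le_rfl) hk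
    omega

/-- The functions for which `x, f x, …, f^[t] x` are distinct. -/
noncomputable def injOrbitFinset {α : Type*} [Fintype α] [DecidableEq α] (x : α) (t : ℕ) :
    Finset (α → α) :=
  {f | Set.InjOn (fun i => f^[i] x) (Set.Iic t)}

theorem mem_injOrbitFinset {α : Type*} [Fintype α] [DecidableEq α] {x : α} {t : ℕ} {f : α → α} :
    f ∈ injOrbitFinset x t ↔ Set.InjOn (fun i => f^[i] x) (Set.Iic t) := by
  simp [injOrbitFinset]

open Function in
theorem update_mem_injOrbitFinset {α : Type*} [Fintype α] [DecidableEq α] {x : α} {t : ℕ}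
    {f : α → α} (hf : f ∈ injOrbitFinset x t) (y : α) :
    update f (f^[t] x) y ∈ injOrbitFinset x t := by
  rw [mem_injOrbitFinset] at *
  exact hf.congr fun i hi => (iterate_update_eq hf y hi).symm

open Function in
/-- Given an injective orbit segment `x, …, f^[t] x`, the next point is uniformly distributed,
independently of the segment. -/
theorem card_mul_sum_injOrbitFinset {α : Type*} [Fintype α] [DecidableEq α] (x : α) (t : ℕ)
    (g : (α → α) → α → ℝ)
    (hg : ∀ f ∈ injOrbitFinset x t, ∀ y z, g (update f (f^[t] x) y) z = g f z) :
    (Fintype.card α : ℝ) * ∑ f ∈ injOrbitFinset x t, g f (f^[t + 1] x) =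
      ∑ f ∈ injOrbitFinset x t, ∑ y, g f y := by
  have key : ∑ p ∈ injOrbitFinset x t ×ˢ (Finset.univ : Finset α), g p.1 (p.1^[t + 1] x) =
      ∑ p ∈ injOrbitFinset x t ×ˢ (Finset.univ : Finset α), g p.1 p.2 := by
    let φ : (α → α) × α → (α → α) × α := fun p =>
      (update p.1 (p.1^[t] x) p.2, p.1 (p.1^[t] x))
    have hmem : ∀ p ∈ injOrbitFinset x t ×ˢ (Finset.univ : Finset α),
        φ p ∈ injOrbitFinset x t ×ˢ (Finset.univ : Finset α) := fun p hp =>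
      Finset.mem_product.2
        ⟨update_mem_injOrbitFinset (Finset.mem_product.1 hp).1 _, Finset.mem_univ _⟩
    have hinv : ∀ p ∈ injOrbitFinset x t ×ˢ (Finset.univ : Finset α), φ (φ p) = p := by
      rintro ⟨f, y⟩ hp
      have hf := mem_injOrbitFinset.1 (Finset.mem_product.1 hp).1
      simp [φ, iterate_update_eq hf y le_rfl]
    refine Finset.sum_nbij' φ φ hmem hmem hinv hinv ?_
    rintro ⟨f, y⟩ hp
    simp only [φ]
    rw [hg f (Finset.mem_product.1 hp).1, iterate_succ_apply']
  rw [Finset.sum_product, Finset.sum_product] at key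
  rw [← key]
  simp [Finset.mul_sum]

theorem mem_injOrbitFinset_succ {α : Type*} [Fintype α] [DecidableEq α] {x : α} {t : ℕ}
    {f : α → α} :
    f ∈ injOrbitFinset x (t + 1) ↔ f ∈ injOrbitFinset x t ∧
      f^[t + 1] x ∉ (Finset.range (t + 1)).image (fun i => f^[i] x) := by
  have hI : Set.Iic (t + 1) = insert (t + 1) (Set.Iic t) := by
    ext i; simp only [Set.mem_Iic, Set.mem_insert_iff]; omega
  rw [mem_injOrbitFinset, mem_injOrbitFinset, hI, Set.injOn_insert (by simp)]
  simp

theorem card_mul_card_injOrbitFinset_succ {α : Type*} [Fintype α] [DecidableEq α] (x : α)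
    (t : ℕ) :
    (Fintype.card α : ℝ) * (injOrbitFinset x (t + 1)).card =
      (Fintype.card α - (t + 1 : ℝ)) * (injOrbitFinset x t).card := by
  have h := card_mul_sum_injOrbitFinset x t
    (fun f y => if y ∉ (Finset.range (t + 1)).image (fun i => f^[i] x) then 1 else 0) (by
      intro f hf y z
      have : (Finset.range (t + 1)).image (fun i => (Function.update f (f^[t] x) y)^[i] x) =
          (Finset.range (t + 1)).image (fun i => f^[i] x) :=
        Finset.image_congr fun i hi => iterate_update_eq (mem_injOrbitFinset.1 hf) y
          (by simpa [Nat.lt_succ_iff] using hi)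
      simp only [this])
  have hA : injOrbitFinset x (t + 1) = (injOrbitFinset x t).filter
      (fun f => f^[t + 1] x ∉ (Finset.range (t + 1)).image (fun i => f^[i] x)) := by
    ext f
    rw [mem_injOrbitFinset_succ, Finset.mem_filter]
  have hsum : ∀ f ∈ injOrbitFinset x t,
      (∑ y, if y ∉ (Finset.range (t + 1)).image (fun i => f^[i] x) then (1 : ℝ) else 0) =
        Fintype.card α - (t + 1 : ℝ) := by
    intro f hf
    have hc : ((Finset.range (t + 1)).image (fun i => f^[i] x)).card = t + 1 := by
      rw [Finset.card_image_of_injOn, Finset.card_range]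
      exact (mem_injOrbitFinset.1 hf).mono fun i hi => by
        simpa [Nat.lt_succ_iff] using hi
    rw [Finset.sum_boole, Finset.filter_notMem_eq_sdiff, ← Finset.compl_eq_univ_sdiff,
      Finset.card_compl, Nat.cast_sub (Finset.card_le_univ _), hc]
    push_cast
    rfl
  rw [Finset.sum_congr rfl hsum, Finset.sum_boole, ← hA, Finset.sum_const, nsmul_eq_mul] at h
  rw [h, mul_comm]

theorem card_injOrbitFinset {α : Type*} [Fintype α] [DecidableEq α] (x : α) (t : ℕ) :
    ((injOrbitFinset x t).card : ℝ) = (Fintype.card α : ℝ) ^ Fintype.card α *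
      ∏ i ∈ Finset.Icc 1 t, (1 - (i : ℝ) / Fintype.card α) := by
  have hα : (Fintype.card α : ℝ) ≠ 0 := by
    have : Nonempty α := ⟨x⟩
    exact_mod_cast Fintype.card_ne_zero
  induction t with
  | zero =>
    have : injOrbitFinset x 0 = Finset.univ := by
      ext f
      simp only [mem_injOrbitFinset, Finset.mem_univ, iff_true]
      intro i hi j hj _
      simp only [Set.mem_Iic] at hi hj
      omega
    simp [this]
  | succ t ih =>
    rw [Finset.prod_Icc_succ_top (by omega), ← mul_assoc, ← ih]
    apply mul_left_cancel₀ hα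
    rw [card_mul_card_injOrbitFinset_succ]
    push_cast
    field_simp

open Function in
theorem minimalPeriod_eq_succ_iff {α : Type*} [Fintype α] [DecidableEq α] {x : α} {t : ℕ}
    {f : α → α} :
    minimalPeriod f x = t + 1 ↔ f ∈ injOrbitFinset x t ∧ f^[t + 1] x = x := by
  rw [mem_injOrbitFinset]
  constructor
  · intro h
    refine ⟨(iterate_injOn_Iio_minimalPeriod (f := f) (x := x)).mono fun i hi => ?_, ?_⟩
    · rw [h]
      exact Nat.lt_succ_of_le hi
    · rw [← h]
      exact isPeriodicPt_minimalPeriod f x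
  · rintro ⟨hinj, hx⟩
    have hp : IsPeriodicPt f (t + 1) x := hx
    refine le_antisymm (hp.minimalPeriod_le t.succ_pos) ?_
    by_contra! hlt
    have hpos := hp.minimalPeriod_pos t.succ_pos
    have := hinj (Set.mem_Iic.2 (Nat.lt_succ_iff.1 hlt)) (Set.mem_Iic.2 t.zero_le)
      (isPeriodicPt_minimalPeriod f x)
    omega

open Function in
theorem ite_cyclic_eq_sum {α : Type*} [Fintype α] [DecidableEq α] (x : α) (f : α → α) :
    (if ∃ t : ℕ, 1 ≤ t ∧ f^[t] x = x then (1 : ℝ) else 0) =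
      ∑ t ∈ Finset.range (Fintype.card α), if minimalPeriod f x = t + 1 then 1 else 0 := by
  split_ifs with h
  · obtain ⟨s, hs, hx⟩ := h
    have hpos : 0 < minimalPeriod f x := IsPeriodicPt.minimalPeriod_pos hs hx
    have hle : minimalPeriod f x ≤ Fintype.card α := minimalPeriod_le_card
    rw [Finset.sum_eq_single (minimalPeriod f x - 1), if_pos (by omega)]
    · intro t _ ht
      exact if_neg (by omega)
    · intro hn
      exact absurd (Finset.mem_range.2 (by omega)) hn
  · refine (Finset.sum_eq_zero fun t _ => if_neg fun ht => h ⟨t + 1, by omega, ?_⟩).symm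
    exact (minimalPeriod_eq_succ_iff.1 ht).2

open Function in
theorem card_mul_sum_minimalPeriod_eq_succ {α : Type*} [Fintype α] [DecidableEq α] (x : α)
    (t : ℕ) :
    (Fintype.card α : ℝ) * ∑ f : α → α, (if minimalPeriod f x = t + 1 then (1 : ℝ) else 0) =
      (injOrbitFinset x t).card := by
  have h := card_mul_sum_injOrbitFinset x t (fun _ y => if y = x then 1 else 0)
    (fun _ _ _ _ => rfl)
  simp only [Finset.sum_ite_eq', Finset.mem_univ, if_true, Finset.sum_const, nsmul_eq_mul,
    mul_one] at h
  rw [← h, Finset.sum_boole, Finset.sum_boole]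
  congr 3
  ext f
  rw [Finset.mem_filter, Finset.mem_filter, minimalPeriod_eq_succ_iff]
  simp

/-- For a uniformly random function `f : Fin n → Fin n` and a
fixed state `x`, the probability that `x` is cyclic equals
`(1/n)·Σ_{t=0}^{n−1} Π_{i=1}^{t} (1 − i/n)`. -/
theorem prob_cyclic_eq
    (n : ℕ) (hn : 1 ≤ n) (x : Fin n) :
    (∑ f : Fin n → Fin n,
        (if ∃ t : ℕ, 1 ≤ t ∧ f^[t] x = x then (1 : ℝ) else 0))
      / (n : ℝ) ^ n
    = (1 / n) * ∑ t ∈ Finset.range n, ∏ i ∈ Finset.Icc 1 t, (1 - (i : ℝ) / n) := by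
  have hn0 : (n : ℝ) ≠ 0 := by exact_mod_cast (by omega : n ≠ 0)
  simp only [ite_cyclic_eq_sum, Fintype.card_fin]
  rw [Finset.sum_comm, Finset.sum_div, Finset.mul_sum]
  refine Finset.sum_congr rfl fun t _ => ?_
  have h := card_mul_sum_minimalPeriod_eq_succ x t
  rw [card_injOrbitFinset, Fintype.card_fin] at h
  rw [div_eq_iff (pow_ne_zero _ hn0)]
  apply mul_left_cancel₀ hn0
  rw [h]
  field_simp
end

section
/- There exists a constant C > 0 such that for all n ≥ 2: if δ : Fin n × {a,b} → Fin n is a uniformly random transition function, then with probability at least 1 − C/n, every nonempty set A ⊆ Fin n that is closed under both transitions (i.e., δ(x,a) ∈ A and δ(x,b) ∈ A for all x ∈ A) has size |A| > (1/2)·log₂ n. Equivalently, with probability at least 1 − C/n, for every state x the set of states reachable from x by words in {a,b}* has size greater than (1/2)·log₂ n. -/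
open scoped BigOperators Classical

/-- `A` is closed under both transitions of `δ`. -/
def IsClosedUnder {n : ℕ} (δ : Fin n × Bool → Fin n) (A : Finset (Fin n)) : Prop :=
  ∀ x ∈ A, δ (x, false) ∈ A ∧ δ (x, true) ∈ A

theorem isClosedUnder_reachable {n : ℕ} (δ : Fin n × Bool → Fin n) (x : Fin n) :
    IsClosedUnder δ (Finset.univ.filter fun y => ∃ ω : List Bool, run δ ω x = y) := by
  intro y hy
  obtain ⟨ω, rfl⟩ := (Finset.mem_filter.1 hy).2
  exact ⟨Finset.mem_filter.2 ⟨Finset.mem_univ _, ω ++ [false], run_append _ _ _ _⟩,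
    Finset.mem_filter.2 ⟨Finset.mem_univ _, ω ++ [true], run_append _ _ _ _⟩⟩

theorem card_isClosedUnder {n : ℕ} (A : Finset (Fin n)) :
    (Finset.univ.filter fun δ : Fin n × Bool → Fin n => IsClosedUnder δ A).card =
      A.card ^ (2 * A.card) * n ^ (2 * (n - A.card)) := by
  have h : (Finset.univ.filter fun δ : Fin n × Bool → Fin n => IsClosedUnder δ A) =
      Fintype.piFinset fun p : Fin n × Bool => if p.1 ∈ A then A else Finset.univ := by
    ext δ
    rw [Finset.mem_filter, Fintype.mem_piFinset]
    simp only [Finset.mem_univ, true_and, IsClosedUnder]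
    constructor
    · rintro h ⟨x, c⟩
      by_cases hx : x ∈ A
      · cases c <;> simp [hx, h x hx]
      · simp [hx]
    · intro h x hx
      exact ⟨by simpa [hx] using h (x, false), by simpa [hx] using h (x, true)⟩
  have hc : (Finset.univ.filter fun x => x ∉ A).card = n - A.card := by
    rw [← Finset.compl_filter, Finset.card_compl]
    simp
  rw [h, Fintype.card_piFinset, Fintype.prod_prod_type]
  rw [Finset.prod_congr rfl fun x _ => show _ = if x ∈ A then A.card ^ 2 else n ^ 2 by
    by_cases hx : x ∈ A <;> simp [hx]]
  rw [Finset.prod_ite, Finset.prod_const, Finset.prod_const, hc, ← pow_mul, ← pow_mul]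
  simp

theorem card_isClosedUnder_div {n : ℕ} (hn : 0 < n) (A : Finset (Fin n)) :
    ((Finset.univ.filter fun δ : Fin n × Bool → Fin n => IsClosedUnder δ A).card : ℝ)
        / (n : ℝ) ^ (2 * n) = ((A.card : ℝ) / n) ^ (2 * A.card) := by
  have hA : A.card ≤ n := by simpa using A.card_le_univ
  have h : (n : ℝ) ^ (2 * n) = (n : ℝ) ^ (2 * A.card) * (n : ℝ) ^ (2 * (n - A.card)) := by
    rw [← pow_add]
    congr 1
    omega
  have hn' : (n : ℝ) ≠ 0 := by positivity
  rw [card_isClosedUnder, h, div_pow]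
  push_cast
  field_simp

theorem choose_mul_div_pow_le {n k : ℕ} (hk : 1 ≤ k) (h : 4 ^ k ≤ n) :
    (n.choose k : ℝ) * ((k : ℝ) / n) ^ (2 * k) ≤ 1 / n * (1 / k.factorial) := by
  have hn : 0 < n := lt_of_lt_of_le (by positivity) h
  have hpow : k ^ (2 * k) * n ≤ n ^ k := by
    obtain ⟨j, rfl⟩ := Nat.exists_eq_add_of_le' hk
    calc (j + 1) ^ (2 * (j + 1)) * n ≤ (2 ^ j) ^ (2 * (j + 1)) * n := by
          gcongr
          exact Nat.lt_two_pow_self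
      _ = (4 ^ (j + 1)) ^ j * n := by
          rw [show 4 = 2 ^ 2 from rfl, ← pow_mul, ← pow_mul, ← pow_mul]
          ring_nf
      _ ≤ n ^ j * n := by gcongr
      _ = n ^ (j + 1) := (pow_succ _ _).symm
  have hpow' : (k : ℝ) ^ (2 * k) * n ≤ (n : ℝ) ^ k := by exact_mod_cast hpow
  have hn' : (0 : ℝ) < n := by exact_mod_cast hn
  calc (n.choose k : ℝ) * ((k : ℝ) / n) ^ (2 * k)
      ≤ (n : ℝ) ^ k / k.factorial * ((k : ℝ) / n) ^ (2 * k) := by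
        gcongr
        exact Nat.choose_le_pow_div k n
    _ = (k : ℝ) ^ (2 * k) / (n : ℝ) ^ k * (1 / k.factorial) := by
        rw [div_pow, two_mul, pow_add (n : ℝ)]
        field_simp
    _ ≤ 1 / n * (1 / k.factorial) := by
        gcongr ?_ * _
        rw [div_le_div_iff₀ (by positivity) hn']
        simpa using hpow'

theorem four_pow_le_of_le_logb {n k : ℕ} (hn : 0 < n)
    (h : (k : ℝ) ≤ 1 / 2 * Real.logb 2 n) : 4 ^ k ≤ n := by
  have h2 : ((2 * k : ℕ) : ℝ) ≤ Real.logb 2 n := by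
    push_cast
    linarith
  rw [Real.le_logb_iff_rpow_le (by norm_num) (by exact_mod_cast hn), Real.rpow_natCast,
    pow_mul] at h2
  norm_num at h2
  exact_mod_cast h2

/-- The expected number of nonempty closed sets `A` with `4 ^ |A| ≤ n` is at most `e / n`. -/
theorem sum_small_sets_le (n : ℕ) :
    ∑ A ∈ Finset.univ.filter (fun A : Finset (Fin n) => 1 ≤ A.card ∧ 4 ^ A.card ≤ n),
      ((A.card : ℝ) / n) ^ (2 * A.card) ≤ Real.exp 1 / n := by
  rw [Finset.sum_filter, ← Finset.powerset_univ, Finset.sum_powerset_apply_card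
    (fun k => if 1 ≤ k ∧ 4 ^ k ≤ n then ((k : ℝ) / n) ^ (2 * k) else 0)]
  calc _ ≤ ∑ k ∈ Finset.range (n + 1), 1 / (n : ℝ) * (1 / k.factorial) := by
        rw [Finset.card_univ, Fintype.card_fin]
        refine Finset.sum_le_sum fun k _ => ?_
        split_ifs with h
        · rw [nsmul_eq_mul]
          exact choose_mul_div_pow_le h.1 h.2
        · rw [smul_zero]
          positivity
    _ ≤ 1 / n * Real.exp 1 := by
        rw [← Finset.mul_sum]
        gcongr
        simpa using Real.sum_le_exp_of_nonneg zero_le_one (n + 1)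
    _ = Real.exp 1 / n := by ring

theorem one_sub_exp_div_le {n : ℕ} (hn : 0 < n) (good : Finset (Fin n × Bool → Fin n))
    (hgood : ∀ δ, (∀ A : Finset (Fin n), A.Nonempty → IsClosedUnder δ A →
      (1 / 2 : ℝ) * Real.logb 2 n < (A.card : ℝ)) → δ ∈ good) :
    1 - Real.exp 1 / n ≤ (good.card : ℝ) / (n : ℝ) ^ (2 * n) := by
  set small := Finset.univ.filter
    (fun A : Finset (Fin n) => 1 ≤ A.card ∧ 4 ^ A.card ≤ n)
  have hcover : goodᶜ ⊆ small.biUnion fun A =>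
      Finset.univ.filter fun δ : Fin n × Bool → Fin n => IsClosedUnder δ A := by
    intro δ hδ
    by_contra hnot
    have hlarge : ∀ A : Finset (Fin n), A.Nonempty → IsClosedUnder δ A →
        (1 / 2 : ℝ) * Real.logb 2 n < (A.card : ℝ) := by
      intro A hA hclosed
      by_contra! hle
      exact hnot (Finset.mem_biUnion.2 ⟨A, Finset.mem_filter.2
        ⟨Finset.mem_univ _, hA.card_pos, four_pow_le_of_le_logb hn hle⟩,
        Finset.mem_filter.2 ⟨Finset.mem_univ _, hclosed⟩⟩)
    exact Finset.mem_compl.1 hδ (hgood δ hlarge)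
  have hbad : ((goodᶜ).card : ℝ) / (n : ℝ) ^ (2 * n) ≤ Real.exp 1 / n := by
    have hcard : ((goodᶜ).card : ℝ) ≤ ∑ A ∈ small,
        ((Finset.univ.filter fun δ : Fin n × Bool → Fin n => IsClosedUnder δ A).card : ℝ) := by
      exact_mod_cast (Finset.card_le_card hcover).trans Finset.card_biUnion_le
    calc ((goodᶜ).card : ℝ) / (n : ℝ) ^ (2 * n) ≤ (∑ A ∈ small,
          ((Finset.univ.filter fun δ : Fin n × Bool → Fin n => IsClosedUnder δ A).card : ℝ)) /
            (n : ℝ) ^ (2 * n) := by gcongr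
      _ = ∑ A ∈ small, ((A.card : ℝ) / n) ^ (2 * A.card) := by
          rw [Finset.sum_div]
          exact Finset.sum_congr rfl fun A _ => card_isClosedUnder_div hn A
      _ ≤ Real.exp 1 / n := sum_small_sets_le n
  have htotal : (good.card : ℝ) + (goodᶜ).card = (n : ℝ) ^ (2 * n) := by
    have h := Finset.card_add_card_compl good
    simp only [Fintype.card_fun, Fintype.card_prod, Fintype.card_fin, Fintype.card_bool] at h
    rw [mul_comm 2 n]
    exact_mod_cast h
  have hsplit : (good.card : ℝ) / (n : ℝ) ^ (2 * n) +
      ((goodᶜ).card : ℝ) / (n : ℝ) ^ (2 * n) = 1 := by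
    rw [← add_div, htotal, div_self (by positivity)]
  linarith

/-- There is a constant `C > 0` such that for all `n ≥ 2`, with
probability at least `1 − C/n`, every nonempty subset of states closed under
both transitions has size greater than `(1/2)·log₂ n`; equivalently, every
reachable set has size greater than `(1/2)·log₂ n`. -/
theorem no_small_closed_set_whp :
    ∃ C : ℝ, 0 < C ∧ ∀ n : ℕ, 2 ≤ n →
      1 - C / n ≤
        ((Finset.univ.filter (fun δ : Fin n × Bool → Fin n =>
            (∀ A : Finset (Fin n), A.Nonempty →
                (∀ x ∈ A, δ (x, false) ∈ A ∧ δ (x, true) ∈ A) →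
                  (1 / 2 : ℝ) * Real.logb 2 n < (A.card : ℝ)) ∧
            (∀ x : Fin n,
                (1 / 2 : ℝ) * Real.logb 2 n <
                  ((Finset.univ.filter (fun y : Fin n =>
                      ∃ ω : List Bool, run δ ω x = y)).card : ℝ)))).card : ℝ)
          / (n : ℝ) ^ (2 * n) := by
  refine ⟨Real.exp 1, Real.exp_pos 1, fun n hn => one_sub_exp_div_le (by omega) _ ?_⟩
  refine fun δ hlarge => Finset.mem_filter.2 ⟨Finset.mem_univ _, hlarge, fun x => ?_⟩
  exact hlarge _ ⟨x, Finset.mem_filter.2 ⟨Finset.mem_univ _, [], rfl⟩⟩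
    (isClosedUnder_reachable δ x)
end

section
/- Let V be a finite set, f : V → V any function, and k ≥ 1 an integer. Then a vertex x belongs to the image of the k-fold iterate f^[k] if and only if either x is cyclic (f^[t](x) = x for some t ≥ 1) or x is the endpoint of a directed path of length k, i.e., there exist pairwise distinct vertices v₀, v₁, …, v_k with f(v_i) = v_{i+1} for all 0 ≤ i < k and v_k = x. -/
/-- A vertex fixed by a positive iterate of `f` lies in the range of every iterate of `f`. -/
theorem mem_range_iterate_of_iterate_eq {V : Type*} {f : V → V} {t : ℕ} {x : V}
    (ht : 1 ≤ t) (hx : f^[t] x = x) (k : ℕ) : x ∈ Set.range f^[k] := by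
  refine ⟨f^[t * k - k] x, ?_⟩
  rw [← Function.iterate_add_apply, Nat.add_sub_of_le (Nat.le_mul_of_pos_left k ht),
    Function.iterate_mul]
  exact Function.iterate_fixed hx k

/-- The endpoint of a directed path of length `k` lies in the range of `f^[k]`. -/
theorem IsPathEndpoint.mem_range_iterate {V : Type*} {f : V → V} {k : ℕ} {x : V}
    (h : IsPathEndpoint f k x) : x ∈ Set.range f^[k] := by
  obtain ⟨v, -, hv, rfl⟩ := h
  have key (i : Fin (k + 1)) : f^[(i : ℕ)] (v 0) = v i := by
    induction i using Fin.induction with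
    | zero => rfl
    | succ i ih => rw [Fin.val_succ, Function.iterate_succ_apply', ← hv i, ← ih, Fin.val_castSucc]
  exact ⟨v 0, key (Fin.last k)⟩

/-- If two of the first `k + 1` iterates of `y` coincide, then `f^[k] y` is cyclic. -/
theorem iterate_cyclic_of_iterate_eq {V : Type*} {f : V → V} {i j k : ℕ} {y : V}
    (hij : i < j) (hik : i ≤ k) (h : f^[i] y = f^[j] y) :
    f^[j - i] (f^[k] y) = f^[k] y := by
  rw [← Function.iterate_add_apply, show j - i + k = k - i + j by omega,
    Function.iterate_add_apply, ← h, ← Function.iterate_add_apply, Nat.sub_add_cancel hik]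

/-- For any function `f` on a finite set `V` and any `k ≥ 1`, a
vertex `x` is in the image of the `k`-fold iterate `f^[k]` iff `x` is cyclic
or `x` is the endpoint of a directed path of length `k`. -/
theorem mem_range_iterate_iff_cyclic_or_pathEndpoint
    {V : Type*} [Fintype V] (f : V → V) (k : ℕ) (hk : 1 ≤ k) (x : V) :
    x ∈ Set.range f^[k] ↔
      (∃ t : ℕ, 1 ≤ t ∧ f^[t] x = x) ∨ IsPathEndpoint f k x := by
  constructor
  · rintro ⟨y, rfl⟩
    by_cases hinj : Function.Injective fun i : Fin (k + 1) => f^[(i : ℕ)] y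
    · exact .inr ⟨_, hinj, fun i => (Function.iterate_succ_apply' f i y).symm, rfl⟩
    · left
      obtain ⟨i, j, h, hne⟩ := Function.not_injective_iff.mp hinj
      rcases lt_or_gt_of_ne hne with hij | hij
      · exact ⟨j - i, Nat.sub_pos_of_lt hij, iterate_cyclic_of_iterate_eq hij i.is_le h⟩
      · exact ⟨i - j, Nat.sub_pos_of_lt hij, iterate_cyclic_of_iterate_eq hij j.is_le h.symm⟩
  · rintro (⟨t, ht, hx⟩ | h)
    · exact mem_range_iterate_of_iterate_eq ht hx k
    · exact h.mem_range_iterate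
end
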